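/- arXiv:2509.14838 — 2 statements merged into one kernel-verified Lean document; each statement's English description precedes it below -/
import Mathlib

section
/- Let Δ be a pure simplicial complex on [n] and let r ≥ 2. Then reg_{≤ r−1} I_{Δ^∨} − indeg I_{Δ^∨} = dim k[Δ] − S_r-depth(k[Δ]). -/
/-!
Common definitions for formalizing "The Serre depth of Stanley–Reisner rings and
the depth of their symbolic powers" (Muta–Terai).
-/

open CategoryTheory MvPolynomial

noncomputable section

namespace SerrePaper

/-! ### Simplicial complexes (given by their sets of faces) -/

variable {V : Type}

/-- A (nonempty, downward closed) abstract simplicial complex, given by its set of faces. -/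
def IsComplex (K : Set (Finset V)) : Prop :=
  K.Nonempty ∧ ∀ F ∈ K, ∀ G ⊆ F, G ∈ K

/-- `F` is a facet (maximal face) of `K`. -/
def IsFacet (K : Set (Finset V)) (F : Finset V) : Prop :=
  F ∈ K ∧ ∀ G ∈ K, F ⊆ G → G = F

/-- `K` is pure: all facets have the same cardinality. -/
def Pure (K : Set (Finset V)) : Prop :=
  ∀ F G : Finset V, IsFacet K F → IsFacet K G → F.card = G.card

/-- `dim K = d - 1`, i.e. the maximal cardinality of a face of `K` is `d`. -/
def HasDimCard (K : Set (Finset V)) (d : ℕ) : Prop :=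
  (∃ F ∈ K, F.card = d) ∧ ∀ F ∈ K, F.card ≤ d

/-- the link of the face `F` in `K`. -/
def link [DecidableEq V] (K : Set (Finset V)) (F : Finset V) : Set (Finset V) :=
  { G | G ∪ F ∈ K ∧ G ∩ F = ∅ }

/-- `skeleton K t` is the `(t-1)`-skeleton `K^{t-1}` of `K`:
all faces with at most `t` vertices. -/
def skeleton (K : Set (Finset V)) (t : ℕ) : Set (Finset V) :=
  { F ∈ K | F.card ≤ t }

/-- The Alexander dual complex `K^∨ = { F | complement of F is not a face of K }`. -/
def dualComplex [Fintype V] [DecidableEq V] (K : Set (Finset V)) : Set (Finset V) :=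
  { F | Fᶜ ∉ K }

/-- The copy of `K` on its own vertex set (as a complex on the corresponding subtype). -/
def restrictVerts (K : Set (Finset V)) : Set (Finset {v : V // {v} ∈ K}) :=
  { F | F.map (Function.Embedding.subtype _) ∈ K }

/-- The induced subcomplex `K_W` on a subset `W` of the vertices. -/
def inducedSub (K : Set (Finset V)) (W : Finset V) : Set (Finset V) :=
  { F ∈ K | F ⊆ W }

/-- `K` is a matroid complex: every induced subcomplex is pure. -/
def IsMatroidComplex (K : Set (Finset V)) : Prop :=
  ∀ W : Finset V, Pure (inducedSub K W)

/-! ### Reduced simplicial homology with coefficients in a field `k` -/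

/-- The group of simplicial `(c-1)`-chains: formal `k`-linear combinations of the
faces of `K` with exactly `c` vertices. -/
abbrev chainGroup (k : Type) [Field k] (K : Set (Finset V)) (c : ℕ) : Type :=
  {F : Finset V // F ∈ K ∧ F.card = c} →₀ k

open Classical in
/-- the boundary of a single face, `∂F = ∑_{x ∈ F} (-1)^{pos of x in F} (F \ {x})`. -/
def boundaryAt (k : Type) [Field k] [LinearOrder V] (K : Set (Finset V)) (c : ℕ)
    (F : {F : Finset V // F ∈ K ∧ F.card = c + 1}) : chainGroup k K c :=
  ∑ x ∈ F.1.attach,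
    if h : F.1.erase x.1 ∈ K then
      Finsupp.single
        ⟨F.1.erase x.1, h, by simp [Finset.card_erase_of_mem x.2, F.2.2]⟩
        ((-1 : k) ^ (F.1.filter (fun y => y < x.1)).card)
    else 0

/-- The simplicial boundary map (for a downward closed `K` this is the usual
boundary map of the reduced (augmented) chain complex of `K`, where faces with
`c` vertices sit in homological degree `c - 1`). -/
def boundary (k : Type) [Field k] [LinearOrder V] (K : Set (Finset V)) (c : ℕ) :
    chainGroup k K (c + 1) →ₗ[k] chainGroup k K c :=
  Finsupp.lsum k fun F => LinearMap.toSpanSingleton k _ (boundaryAt k K c F)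

/-- `H̃ᵢ(K; k) = 0`: every reduced `i`-cycle is a boundary.  (For `i ≤ -2` this holds
trivially; for `i = -1` the relevant cycle group is the whole of the `(-1)`-chains.) -/
def reducedHomologyVanishes (k : Type) [Field k] [LinearOrder V]
    (K : Set (Finset V)) (i : ℤ) : Prop :=
  if i < -1 then True
  else if i = -1 then
    ∀ z : chainGroup k K 0, ∃ b : chainGroup k K 1, boundary k K 0 b = z
  else
    ∀ z : chainGroup k K (i.toNat + 1), boundary k K i.toNat z = 0 →
      ∃ b : chainGroup k K (i.toNat + 2), boundary k K (i.toNat + 1) b = z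

/-- Nonvanishing `β_{i,j}(k[K]) ≠ 0` of the graded Betti numbers of the
Stanley–Reisner ring of `K`, expressed via Hochster's formula:
`β_{i,j}(k[K]) = ∑_{W ⊆ V, |W| = j} dim_k H̃_{j-i-1}(K_W; k)`. -/
def bettiNonzero (k : Type) [Field k] [LinearOrder V] (K : Set (Finset V)) (i j : ℕ) : Prop :=
  ∃ W : Finset V, W.card = j ∧
    ¬ reducedHomologyVanishes k (inducedSub K W) ((j : ℤ) - i - 1)

/-- `reg_{≤ r} I_K = max{ j : β_{i,i+j}(I_K) ≠ 0 for some i ≤ r }`, where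
`β_{i,d}(I_K) = β_{i+1,d}(k[K])`. -/
def regLEIdeal (k : Type) [Field k] [LinearOrder V] (K : Set (Finset V)) (r : ℕ) : ℕ :=
  sSup { j : ℕ | ∃ i ≤ r, bettiNonzero k K (i + 1) (i + j) }

/-- `indeg I_K`: the least degree of a minimal generator of the Stanley–Reisner
ideal of `K`, i.e. `min{ j : β_{0,j}(I_K) = β_{1,j}(k[K]) ≠ 0 }`. -/
def indegIdeal (k : Type) [Field k] [LinearOrder V] (K : Set (Finset V)) : ℕ :=
  sInf { j : ℕ | bettiNonzero k K 1 j }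

/-! ### Stanley–Reisner rings, Serre depth, depth, symbolic powers -/

variable (k : Type) [Field k]

/-- The Stanley–Reisner ideal of `K` (generated by the monomials of the non-faces,
equivalently by those of the minimal non-faces). -/
def srIdeal (K : Set (Finset V)) : Ideal (MvPolynomial V k) :=
  Ideal.span { m | ∃ F : Finset V, F ∉ K ∧ m = ∏ i ∈ F, X i }

/-- The homogeneous maximal ideal `(x_v : v ∈ V)` of the polynomial ring. -/
def maxIdeal (V : Type) : Ideal (MvPolynomial V k) :=
  Ideal.span (Set.range X)

/-- The quotient ring `S/I` as an object of `ModuleCat S`. -/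
def quotMod {V : Type} (I : Ideal (MvPolynomial V k)) : ModuleCat (MvPolynomial V k) :=
  ModuleCat.of _ (MvPolynomial V k ⧸ I)

/-- The Stanley–Reisner ring `k[K] = S/I_K` as a module over `S`. -/
def srRing (K : Set (Finset V)) : ModuleCat (MvPolynomial V k) :=
  quotMod k (srIdeal k K)

/-- The Krull dimension of a module, `dim M = dim (R / ann M)` (so `dim 0 = ⊥ = -∞`). -/
def modDim {R : Type} [CommRing R] (M : ModuleCat R) : WithBot ℕ∞ :=
  ringKrullDim (R ⧸ Module.annihilator R M)

/-- `Ext_R^i(M, N)` as an `R`-module. -/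
def extM {R : Type} [CommRing R] (M N : ModuleCat R) (i : ℕ) : ModuleCat R :=
  ((Ext R (ModuleCat R) i).obj (Opposite.op M)).obj N

/-- `K_M^j = Ext_S^{n-j}(M, ω_S)`, the (Matlis dual of) local cohomology; since the
canonical module `ω_S` of the polynomial ring `S` is `S` itself up to a
grading shift, we use `Ext_S^{n-j}(M, S)`. -/
def serreK {V : Type} (M : ModuleCat (MvPolynomial V k)) (j : ℕ) :
    ModuleCat (MvPolynomial V k) :=
  extM M (ModuleCat.of _ (MvPolynomial V k)) (Nat.card V - j)

/-- The Serre depth `S_r-depth(M) = min{ j : dim K_M^j ≥ j - r + 1 }`.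
(Note that, since `dim K_M^j` is either `⊥` or `≥ 0`, the inequality
`dim K_M^j ≥ j - r + 1` of (possibly negative) integers is equivalent to
`(j + 1 - r : ℕ) ≤ dim K_M^j` with truncated subtraction.) -/
def serreDepth {V : Type} (r : ℕ) (M : ModuleCat (MvPolynomial V k)) : ℕ :=
  sInf { j : ℕ | ((j + 1 - r : ℕ) : WithBot ℕ∞) ≤ modDim (serreK k M j) }

/-- Serre's condition `(S_r)` for an unmixed module: `S_r-depth(M) = dim M`. -/
def serreCond {V : Type} (r : ℕ) (M : ModuleCat (MvPolynomial V k)) : Prop :=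
  (serreDepth k r M : WithBot ℕ∞) = modDim M

/-- The depth of `M` with respect to the homogeneous maximal ideal,
via Rees' characterization `depth M = min{ i : Ext^i(S/m, M) ≠ 0 }`. -/
def mdepth {V : Type} (M : ModuleCat (MvPolynomial V k)) : ℕ :=
  sInf { i : ℕ | Nontrivial (extM (quotMod k (maxIdeal k V)) M i) }

/-- `M` is Cohen–Macaulay: `depth M = dim M`. -/
def isCM {V : Type} (M : ModuleCat (MvPolynomial V k)) : Prop :=
  (mdepth k M : WithBot ℕ∞) = modDim M

/-- The `ℓ`-th symbolic power of a (radical, e.g. squarefree monomial) ideal: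
`I^(ℓ) = ⋂_{P ∈ Min(I)} P^ℓ`. -/
def symbPow {R : Type} [CommRing R] (I : Ideal R) (ℓ : ℕ) : Ideal R :=
  sInf { J | ∃ P ∈ I.minimalPrimes, J = P ^ ℓ }

/-- The height of an ideal: the Krull dimension of the poset of primes contained in it. -/
def idealHeight {R : Type} [CommRing R] (p : Ideal R) : WithBot ℕ∞ :=
  Order.krullDim { q : PrimeSpectrum R // q.asIdeal ≤ p }

/-- `R/I` is unmixed: all associated primes of `R/I` have the same height. -/
def IsUnmixedIdeal {R : Type} [CommRing R] (I : Ideal R) : Prop :=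
  ∀ p q : Ideal R, p ∈ associatedPrimes R (R ⧸ I) → q ∈ associatedPrimes R (R ⧸ I) →
    idealHeight p = idealHeight q

/-- Nonvanishing of the first local cohomology `H_m^1(S/I) ≠ 0`. -/
def H1NE {V : Type} (I : Ideal (MvPolynomial V k)) : Prop :=
  Nontrivial ((localCohomology (maxIdeal k V) 1).obj (quotMod k I))

/-- `I` is a squarefree monomial ideal. -/
def IsSqFreeMonomialIdeal {V : Type} (I : Ideal (MvPolynomial V k)) : Prop :=
  ∃ G : Set (Finset V), I = Ideal.span ((fun F => ∏ i ∈ F, X i) '' G)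

end SerrePaper

end

/-! ### Signs and the Koszul differential -/

namespace SerrePaper

section Koszul

variable {V : Type} [LinearOrder V] {R : Type} [CommRing R]

/-- The sign `(-1) ^ #{u ∈ H | u < v}`. -/
def sgn (R : Type) [CommRing R] (v : V) (H : Finset V) : R :=
  (-1) ^ (H.filter (fun u => u < v)).card

lemma sgn_mul_self (v : V) (H : Finset V) : sgn R v H * sgn R v H = 1 := by
  rw [sgn, ← mul_pow]; simp

lemma sgn_insert_self (v : V) (H : Finset V) : sgn R v (insert v H) = sgn R v H := by
  simp [sgn, Finset.filter_insert]

lemma sgn_insert_of_lt {u v : V} {H : Finset V} (h : v < u) (hv : v ∉ H) :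
    sgn R u (insert v H) = -sgn R u H := by
  simp [sgn, Finset.filter_insert, h, hv, pow_succ]

lemma sgn_insert_of_gt {u v : V} {H : Finset V} (h : u < v) :
    sgn R u (insert v H) = sgn R u H := by
  simp [sgn, Finset.filter_insert, h.not_gt]

lemma sgn_erase_self (v : V) (H : Finset V) : sgn R v (H.erase v) = sgn R v H := by
  by_cases h : v ∈ H
  · rw [← sgn_insert_self, Finset.insert_erase h]
  · rw [Finset.erase_eq_of_notMem h]

lemma sgn_union_of_disjoint {v : V} {G H : Finset V} (h : Disjoint G H) :
    sgn R v (G ∪ H) = sgn R v G * sgn R v H := by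
  rw [sgn, Finset.filter_union, Finset.card_union_of_disjoint
    (Finset.disjoint_filter_filter h), pow_add]; rfl

/-- The Koszul differential on families indexed by finite sets. -/
def koszul (y : V → R) (φ : Finset V → R) (G : Finset V) : R :=
  ∑ v ∈ G, sgn R v G * (y v * φ (G.erase v))

/-- An antisymmetric sum over ordered pairs of distinct elements vanishes. -/
lemma sum_sum_erase_eq_zero (U : Finset V) (g : V → V → R)
    (hg : ∀ v ∈ U, ∀ w ∈ U, v ≠ w → g v w + g w v = 0) :
    ∑ v ∈ U, ∑ w ∈ U.erase v, g v w = 0 := by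
  rw [Finset.sum_sigma']
  refine Finset.sum_involution (fun p _ => ⟨p.2, p.1⟩) ?_ ?_ ?_ ?_
  · rintro ⟨v, w⟩ h
    simp only [Finset.mem_sigma, Finset.mem_erase] at h
    exact hg v h.1 w h.2.2 h.2.1.symm
  · rintro ⟨v, w⟩ h _ he
    simp only [Finset.mem_sigma, Finset.mem_erase] at h
    simp only [Sigma.mk.injEq] at he
    exact h.2.1 he.1
  · rintro ⟨v, w⟩ h
    simp only [Finset.mem_sigma, Finset.mem_erase] at h ⊢
    exact ⟨h.2.2, h.2.1.symm, h.1⟩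
  · rintro ⟨v, w⟩ h
    rfl

lemma sgn_mul_sgn_erase {v w : V} {H : Finset V} (hv : v ∈ H) (hw : w ∈ H) (h : v ≠ w) :
    sgn R v H * sgn R w (H.erase v) + sgn R w H * sgn R v (H.erase w) = 0 := by
  wlog hlt : v < w generalizing v w
  · rw [add_comm]
    exact this hw hv h.symm (lt_of_le_of_ne (not_lt.1 hlt) h.symm)
  have h1 : sgn R w H = -sgn R w (H.erase v) := by
    conv_lhs => rw [← Finset.insert_erase hv]
    exact sgn_insert_of_lt hlt (Finset.notMem_erase _ _)
  have h2 : sgn R v H = sgn R v (H.erase w) := by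
    conv_lhs => rw [← Finset.insert_erase hw]
    exact sgn_insert_of_gt hlt
  rw [h1, h2]; ring

lemma sgn_mul_sgn_insert {v w : V} {H : Finset V} (hv : v ∉ H) (hw : w ∉ H) (h : v ≠ w) :
    sgn R v H * sgn R w (insert v H) + sgn R w H * sgn R v (insert w H) = 0 := by
  wlog hlt : v < w generalizing v w
  · rw [add_comm]
    exact this hw hv h.symm (lt_of_le_of_ne (not_lt.1 hlt) h.symm)
  rw [sgn_insert_of_lt hlt hv, sgn_insert_of_gt hlt]; ring

lemma koszul_koszul (y : V → R) (φ : Finset V → R) (G : Finset V) :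
    koszul y (koszul y φ) G = 0 := by
  simp only [koszul, Finset.mul_sum]
  refine sum_sum_erase_eq_zero G _ fun v hv w hw h => ?_
  rw [Finset.erase_right_comm (a := w) (b := v)]
  linear_combination (y v * y w * φ ((G.erase v).erase w)) * sgn_mul_sgn_erase (R := R) hv hw h

lemma koszul_congr {y : V → R} {φ ψ : Finset V → R} {G : Finset V}
    (h : ∀ v ∈ G, φ (G.erase v) = ψ (G.erase v)) : koszul y φ G = koszul y ψ G :=
  Finset.sum_congr rfl fun v hv => by rw [h v hv]

lemma koszul_sub (y : V → R) (φ ψ : Finset V → R) (G : Finset V) :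
    koszul y (fun H => φ H - ψ H) G = koszul y φ G - koszul y ψ G := by
  simp only [koszul, ← Finset.sum_sub_distrib]
  exact Finset.sum_congr rfl fun v _ => by ring

lemma koszul_smul (y : V → R) (a : R) (φ : Finset V → R) (G : Finset V) :
    koszul y (fun H => a * φ H) G = a * koszul y φ G := by
  simp only [koszul, Finset.mul_sum]
  exact Finset.sum_congr rfl fun v _ => by ring

lemma koszul_insert_of_lt (y : V → R) (φ : Finset V → R) {G : Finset V} {v : V}
    (h : ∀ u ∈ G, v < u) :
    koszul y φ (insert v G) = y v * φ G - koszul y (fun H => φ (insert v H)) G := by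
  have hv : v ∉ G := fun hv => lt_irrefl _ (h v hv)
  rw [koszul, Finset.sum_insert hv, sgn_insert_self, Finset.erase_insert hv, sub_eq_add_neg]
  congr 1
  · have : G.filter (fun u => u < v) = ∅ := by
      ext u; simp only [Finset.mem_filter, Finset.notMem_empty, iff_false, not_and]
      exact fun hu => (h u hu).not_gt
    simp [sgn, this]
  · rw [koszul, ← Finset.sum_neg_distrib]
    refine Finset.sum_congr rfl fun u hu => ?_
    rw [sgn_insert_of_lt (h u hu) hv, Finset.erase_insert_of_ne (h u hu).ne]
    ring

lemma koszul_mem_span (y : V → R) (φ : Finset V → R) (G : Finset V) :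
    koszul y φ G ∈ Ideal.span (y '' G) :=
  Ideal.sum_mem _ fun v hv => Ideal.mul_mem_left _ _ <| Ideal.mul_mem_right _ _ <|
    Ideal.subset_span ⟨v, hv, rfl⟩

/-- Exactness of the augmented Koszul complex of a sequence each of whose members is a
nonzerodivisor modulo any set of others. -/
theorem exists_koszul_eq (y : V → R) (W : Finset V)
    (hy : ∀ U ⊆ W, ∀ v ∈ W, v ∉ U → ∀ a,
      y v * a ∈ Ideal.span (y '' U) → a ∈ Ideal.span (y '' U))
    (φ : Finset V → R) (hφ : ∀ G ⊆ W, koszul y φ G = 0)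
    (hW : φ W ∈ Ideal.span (y '' W)) :
    ∃ ψ : Finset V → R, ∀ G ⊆ W, φ G = koszul y ψ G := by
  induction W using Finset.induction_on_min generalizing φ with
  | empty =>
    refine ⟨0, fun G hG => ?_⟩
    obtain rfl := Finset.subset_empty.1 hG
    simpa [koszul] using hW
  | insert v W hv ih =>
    have hvW : v ∉ W := fun h => lt_irrefl _ (hv v h)
    have hlt : ∀ G ⊆ W, ∀ u ∈ G, v < u := fun G hG u hu => hv u (hG hu)
    replace ih := ih fun U hU u hu =>
      hy U (hU.trans (Finset.subset_insert _ _)) u (Finset.mem_insert_of_mem hu)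
    have h1 : ∀ G ⊆ W, y v * φ G = koszul y (fun H => φ (insert v H)) G := fun G hG => by
      have := hφ (insert v G) (Finset.insert_subset_insert _ hG)
      rwa [koszul_insert_of_lt _ _ (hlt G hG), sub_eq_zero] at this
    obtain ⟨ψ₀, hψ₀⟩ := ih φ (fun G hG => hφ G (hG.trans (Finset.subset_insert _ _))) <| by
      refine hy W (Finset.subset_insert _ _) v (Finset.mem_insert_self _ _) hvW _ ?_
      rw [h1 W subset_rfl]; exact koszul_mem_span _ _ _
    rw [Finset.coe_insert, Set.image_insert_eq, Ideal.span_insert, Submodule.mem_sup] at hW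
    obtain ⟨a, ha, c, hc, hac⟩ := hW
    obtain ⟨b, rfl⟩ := Ideal.mem_span_singleton'.1 ha
    let ψ₀' : Finset V → R := fun G => if G = W then b else ψ₀ G
    have hψ₀' : ∀ G ⊆ W, φ G = koszul y ψ₀' G := fun G hG => by
      rw [hψ₀ G hG]
      refine koszul_congr fun u hu => ?_
      have : G.erase u ≠ W := fun h => by
        have := hG hu; rw [← h] at this; simp at this
      simp [ψ₀', this]
    obtain ⟨ψ₁, hψ₁⟩ := ih (fun G => y v * ψ₀' G - φ (insert v G)) (fun G hG => by
        rw [koszul_sub, koszul_smul, ← hψ₀' G hG, h1 G hG, sub_self]) (by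
        have : y v * ψ₀' W - φ (insert v W) = -c := by
          rw [← hac]; simp only [ψ₀', if_true]; ring
        rw [this]; exact neg_mem hc)
    refine ⟨fun G => if v ∈ G then ψ₁ (G.erase v) else ψ₀' G, fun G hG => ?_⟩
    by_cases hvG : v ∈ G
    · have hG' : G.erase v ⊆ W := by
        rw [← Finset.erase_insert hvW]; exact Finset.erase_subset_erase _ hG
      have key := hψ₁ _ hG'
      simp only [Finset.insert_erase hvG] at key
      conv_rhs => rw [← Finset.insert_erase hvG]
      rw [koszul_insert_of_lt _ _ (hlt _ hG'), if_neg (Finset.notMem_erase _ _)]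
      have : koszul y (fun H => if v ∈ insert v H then ψ₁ ((insert v H).erase v)
          else ψ₀' (insert v H)) (G.erase v) = koszul y ψ₁ (G.erase v) := by
        refine koszul_congr fun u hu => ?_
        simp [Finset.erase_insert (a := v) (s := (G.erase v).erase u) (by simp)]
      rw [this, ← key]; ring
    · have hG' : G ⊆ W := (Finset.subset_insert_iff_of_notMem hvG).1 hG
      rw [hψ₀' G hG']
      refine koszul_congr fun u hu => ?_
      rw [if_neg fun h => hvG (Finset.mem_of_mem_erase h)]

end Koszul

end SerrePaper

/-! ### A free resolution of a Stanley–Reisner ring and its dual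

The resolution has a basis indexed by pairs `(F, H)` of disjoint sets with `F` a face, in
homological degree `#H`.  Chains and cochains are families `φ F H`, of which only the values at
disjoint pairs matter. -/

namespace SerrePaper

section RegularSubsets

variable {V : Type} {R : Type} [CommRing R]

/-- `y` is a sequence each of whose members is a nonzerodivisor modulo any set of others. -/
def RegularSubsets (y : V → R) : Prop :=
  ∀ (U : Finset V) (v : V), v ∉ U → ∀ a,
    y v * a ∈ Ideal.span (y '' U) → a ∈ Ideal.span (y '' U)

lemma span_image_sign_mul (x : V → R) (e : V → R) (he : ∀ v, e v * e v = 1) (U : Finset V) :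
    Ideal.span ((fun v => e v * x v) '' U) = Ideal.span (x '' U) := by
  apply le_antisymm <;> rw [Ideal.span_le]
  · rintro _ ⟨v, hv, rfl⟩
    exact Ideal.mul_mem_left _ _ (Ideal.subset_span ⟨v, hv, rfl⟩)
  · rintro _ ⟨v, hv, rfl⟩
    have : x v = e v * (e v * x v) := by rw [← mul_assoc, he, one_mul]
    rw [this]
    exact Ideal.mul_mem_left _ _ (Ideal.subset_span ⟨v, hv, rfl⟩)

lemma RegularSubsets.sign_mul {x : V → R} (hx : RegularSubsets x) (e : V → R)
    (he : ∀ v, e v * e v = 1) : RegularSubsets (fun v => e v * x v) := by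
  intro U v hv a ha
  rw [span_image_sign_mul x e he] at ha ⊢
  refine hx U v hv a ?_
  have : x v * a = e v * (e v * x v * a) := by
    rw [show e v * (e v * x v * a) = (e v * e v) * (x v * a) by ring, he, one_mul]
  rw [this]; exact Ideal.mul_mem_left _ _ ha

lemma sum_sum_mem_eq_sum_sum_compl [Fintype V] [DecidableEq V] (g : V → Finset V → R) :
    ∑ H : Finset V, ∑ v ∈ H, g v (H.erase v) = ∑ H : Finset V, ∑ v ∈ Hᶜ, g v H := by
  rw [Finset.sum_sigma', Finset.sum_sigma']
  refine Finset.sum_nbij' (fun p => ⟨p.1.erase p.2, p.2⟩) (fun p => ⟨insert p.2 p.1, p.2⟩)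
    ?_ ?_ ?_ ?_ ?_
  · rintro ⟨H, v⟩ h; simp
  · rintro ⟨H, v⟩ h; simp
  · rintro ⟨H, v⟩ h
    simp only [Finset.mem_sigma, Finset.mem_univ, true_and] at h
    simp [Finset.insert_erase h]
  · rintro ⟨H, v⟩ h
    simp only [Finset.mem_sigma, Finset.mem_univ, Finset.mem_compl, true_and] at h
    simp [Finset.erase_insert h]
  · rintro ⟨H, v⟩ h; rfl

lemma sum_filter_notMem_eq_sum_filter_mem [Fintype V] [DecidableEq V] (v : V) (g : Finset V → R) :
    ∑ F : Finset V with v ∉ F, g F = ∑ F : Finset V with v ∈ F, g (F.erase v) := by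
  refine Finset.sum_nbij' (fun F => insert v F) (fun F => F.erase v) ?_ ?_ ?_ ?_ ?_
  · intro F _; simp
  · intro F _; simp
  · intro F hF; exact Finset.erase_insert (by simpa using hF)
  · intro F hF; exact Finset.insert_erase (by simpa using hF)
  · intro F hF
    rw [Finset.erase_insert (by simpa using hF)]

variable [LinearOrder V]

lemma koszul_truncate (y : V → R) (φ : Finset V → R) (m : ℕ) (G : Finset V) :
    koszul y (fun H => if H.card + 1 = m then φ H else 0) G =
      if G.card = m then koszul y φ G else 0 := by
  split_ifs with h
  · refine koszul_congr fun v hv => ?_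
    rw [if_pos (by rw [Finset.card_erase_add_one hv, h])]
  · refine Finset.sum_eq_zero fun v hv => ?_
    have : (G.erase v).card + 1 ≠ m := by rwa [Finset.card_erase_add_one hv]
    simp [this]

lemma RegularSubsets.of_prod_mul_mem {x : V → R} (hx : RegularSubsets x) (U F : Finset V)
    (hF : Disjoint F U) (a : R) (ha : (∏ v ∈ F, x v) * a ∈ Ideal.span (x '' U)) :
    a ∈ Ideal.span (x '' U) := by
  induction F using Finset.induction_on with
  | empty => simpa using ha
  | insert v F hv ih =>
    rw [Finset.disjoint_insert_left] at hF
    rw [Finset.prod_insert hv, mul_assoc] at ha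
    exact ih hF.2 (hx U v hF.1 _ ha)

/-- Graded version of the exactness of the augmented Koszul complex. -/
theorem RegularSubsets.exists_koszul_eq {y : V → R} (hy : RegularSubsets y) (W : Finset V) (m : ℕ)
    (φ : Finset V → R) (hm : ∀ G ⊆ W, G.card ≠ m → φ G = 0)
    (hφ : ∀ G ⊆ W, koszul y φ G = 0) (hW : φ W ∈ Ideal.span (y '' W)) :
    ∃ ψ : Finset V → R, (∀ G, G.card + 1 ≠ m → ψ G = 0) ∧ ψ W = 0 ∧
      ∀ G ⊆ W, φ G = koszul y ψ G := by
  obtain ⟨ψ, hψ⟩ := SerrePaper.exists_koszul_eq y W (fun U _ v _ => hy U v) φ hφ hW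
  refine ⟨fun H => if H.card + 1 = m then (if H = W then 0 else ψ H) else 0,
    fun G hG => if_neg hG, by simp, fun G hG => ?_⟩
  rw [koszul_truncate]
  split_ifs with h
  · rw [hψ G hG]
    refine koszul_congr fun v hv => ?_
    rw [if_neg]
    rintro rfl
    exact Finset.notMem_erase _ _ (hG hv)
  · exact hm G hG h

end RegularSubsets

section Resolution

variable {V : Type} [LinearOrder V] {R : Type} [CommRing R] (x : V → R)

/-- The codifferential: `(F, H)` receives contributions from removing `v ∈ H`, either
discarding it (with coefficient `x v`) or moving it to `F`. -/
def codiff (φ : Finset V → Finset V → R) (F H : Finset V) : R :=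
  ∑ v ∈ H, sgn R v H * (x v * φ F (H.erase v) + φ (insert v F) (H.erase v))

lemma codiff_sub (φ ψ : Finset V → Finset V → R) (F H : Finset V) :
    codiff x (fun F H => φ F H - ψ F H) F H = codiff x φ F H - codiff x ψ F H := by
  simp only [codiff, ← Finset.sum_sub_distrib]
  exact Finset.sum_congr rfl fun v _ => by ring

lemma codiff_add (φ ψ : Finset V → Finset V → R) (F H : Finset V) :
    codiff x (fun F H => φ F H + ψ F H) F H = codiff x φ F H + codiff x ψ F H := by
  simp only [codiff, ← Finset.sum_add_distrib]
  exact Finset.sum_congr rfl fun v _ => by ring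

lemma codiff_smul (a : R) (φ : Finset V → Finset V → R) (F H : Finset V) :
    codiff x (fun F H => a * φ F H) F H = a * codiff x φ F H := by
  simp only [codiff, Finset.mul_sum]
  exact Finset.sum_congr rfl fun v _ => by ring

lemma codiff_codiff (φ : Finset V → Finset V → R) (F H : Finset V) :
    codiff x (codiff x φ) F H = 0 := by
  have : codiff x (codiff x φ) F H = ∑ v ∈ H, ∑ w ∈ H.erase v,
      sgn R v H * sgn R w (H.erase v) * (x v * x w * φ F ((H.erase v).erase w) +
        x v * φ (insert w F) ((H.erase v).erase w) + x w * φ (insert v F) ((H.erase v).erase w) +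
        φ (insert w (insert v F)) ((H.erase v).erase w)) := by
    rw [codiff]
    refine Finset.sum_congr rfl fun v _ => ?_
    simp only [codiff, Finset.mul_sum, ← Finset.sum_add_distrib]
    exact Finset.sum_congr rfl fun w _ => by ring
  rw [this]
  refine sum_sum_erase_eq_zero H _ fun v hv w hw h => ?_
  rw [Finset.erase_right_comm (a := w) (b := v), Finset.insert_comm w v]
  linear_combination (x v * x w * φ F ((H.erase v).erase w) +
        x v * φ (insert w F) ((H.erase v).erase w) + x w * φ (insert v F) ((H.erase v).erase w) +
        φ (insert v (insert w F)) ((H.erase v).erase w)) * sgn_mul_sgn_erase (R := R) hv hw h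

lemma codiff_congr {φ ψ : Finset V → Finset V → R} {F H : Finset V} (hFH : Disjoint F H)
    (h : ∀ F' H', Disjoint F' H' → F ⊆ F' → H'.card + 1 = H.card → φ F' H' = ψ F' H') :
    codiff x φ F H = codiff x ψ F H := by
  refine Finset.sum_congr rfl fun v hv => ?_
  have hd : Disjoint F (H.erase v) := hFH.mono_right (Finset.erase_subset _ _)
  have hc := Finset.card_erase_add_one hv
  rw [h _ _ hd subset_rfl hc,
    h (insert v F) (H.erase v) (by simp [hd]) (Finset.subset_insert _ _) hc]

variable [Fintype V]

/-- The differential, adjoint to `codiff`. -/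
def diff (ψ : Finset V → Finset V → R) (F H : Finset V) : R :=
  ∑ v ∈ Hᶜ, sgn R v H *
    if v ∈ F then ψ (F.erase v) (insert v H) else x v * ψ F (insert v H)

lemma diff_sub (φ ψ : Finset V → Finset V → R) (F H : Finset V) :
    diff x (fun F H => φ F H - ψ F H) F H = diff x φ F H - diff x ψ F H := by
  simp only [diff, ← Finset.sum_sub_distrib]
  exact Finset.sum_congr rfl fun v _ => by split_ifs <;> ring

lemma diff_add (φ ψ : Finset V → Finset V → R) (F H : Finset V) :
    diff x (fun F H => φ F H + ψ F H) F H = diff x φ F H + diff x ψ F H := by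
  simp only [diff, ← Finset.sum_add_distrib]
  exact Finset.sum_congr rfl fun v _ => by split_ifs <;> ring

lemma diff_smul (a : R) (φ : Finset V → Finset V → R) (F H : Finset V) :
    diff x (fun F H => a * φ F H) F H = a * diff x φ F H := by
  simp only [diff, Finset.mul_sum]
  exact Finset.sum_congr rfl fun v _ => by split_ifs <;> ring

lemma diff_congr {φ ψ : Finset V → Finset V → R} {F H : Finset V} (hFH : Disjoint F H)
    (h : ∀ F' H', Disjoint F' H' → F' ⊆ F → H'.card = H.card + 1 → φ F' H' = ψ F' H') :
    diff x φ F H = diff x ψ F H := by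
  refine Finset.sum_congr rfl fun v hv => ?_
  rw [Finset.mem_compl] at hv
  have hc := Finset.card_insert_of_notMem hv
  split_ifs with hvF
  · rw [h _ _ _ (Finset.erase_subset _ _) hc]
    rw [Finset.disjoint_insert_right]
    exact ⟨Finset.notMem_erase _ _, hFH.mono_left (Finset.erase_subset _ _)⟩
  · rw [h _ _ _ subset_rfl hc]
    rw [Finset.disjoint_insert_right]
    exact ⟨hvF, hFH⟩

lemma diff_diff (ψ : Finset V → Finset V → R) (F H : Finset V) :
    diff x (diff x ψ) F H = 0 := by
  have : diff x (diff x ψ) F H = ∑ v ∈ Hᶜ, ∑ w ∈ Hᶜ.erase v,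
      sgn R v H * sgn R w (insert v H) *
        if v ∈ F then
          if w ∈ F then ψ ((F.erase v).erase w) (insert w (insert v H))
          else x w * ψ (F.erase v) (insert w (insert v H))
        else
          if w ∈ F then x v * ψ (F.erase w) (insert w (insert v H))
          else x v * x w * ψ F (insert w (insert v H)) := by
    rw [diff]
    refine Finset.sum_congr rfl fun v _ => ?_
    simp only [diff, Finset.compl_insert]
    split_ifs with hv
    · rw [Finset.mul_sum]
      refine Finset.sum_congr rfl fun w hw => ?_
      have hwv : w ≠ v := (Finset.mem_erase.1 hw).1
      simp only [Finset.mem_erase, hwv, ne_eq, not_false_eq_true, true_and]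
      ring
    · simp only [Finset.mul_sum]
      refine Finset.sum_congr rfl fun w hw => ?_
      split_ifs <;> ring
  rw [this]
  refine sum_sum_erase_eq_zero _ _ fun v hv w hw h => ?_
  rw [Finset.mem_compl] at hv hw
  have key := sgn_mul_sgn_insert (R := R) hv hw h
  rw [Finset.insert_comm v w]
  split_ifs
  · rw [Finset.erase_right_comm (a := w) (b := v)]
    linear_combination (ψ ((F.erase v).erase w) (insert w (insert v H))) * key
  · linear_combination (x w * ψ (F.erase v) (insert w (insert v H))) * key
  · linear_combination (x v * ψ (F.erase w) (insert w (insert v H))) * key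
  · linear_combination (x v * x w * ψ F (insert w (insert v H))) * key

/-- `diff` and `codiff` are adjoint. -/
lemma sum_diff_mul (φ ψ : Finset V → Finset V → R)
    (hψ : ∀ F H, ¬ Disjoint F H → ψ F H = 0) :
    ∑ F : Finset V, ∑ H : Finset V, diff x ψ F H * φ F H =
      ∑ F : Finset V, ∑ H : Finset V, ψ F H * codiff x φ F H := by
  have hψ' : ∀ {F H : Finset V} {v : V}, v ∈ F → ψ F (insert v H) = 0 := fun {F H v} hv =>
    hψ _ _ (by simp [Finset.disjoint_insert_right, hv])
  have hR : ∀ F, ∑ H : Finset V, ψ F H * codiff x φ F H =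
      ∑ H : Finset V, ∑ v ∈ Hᶜ, sgn R v H *
        (ψ F (insert v H) * (x v * φ F H + φ (insert v F) H)) := by
    intro F
    rw [← sum_sum_mem_eq_sum_sum_compl]
    refine Finset.sum_congr rfl fun H _ => ?_
    rw [codiff, Finset.mul_sum]
    refine Finset.sum_congr rfl fun v hv => ?_
    rw [Finset.insert_erase hv, sgn_erase_self]; ring
  simp only [hR, diff, Finset.sum_mul]
  have hswap : ∀ g : Finset V → Finset V → V → R, ∑ F : Finset V, ∑ H : Finset V,
      ∑ v ∈ Hᶜ, g F H v = ∑ H : Finset V, ∑ v ∈ Hᶜ, ∑ F : Finset V, g F H v := fun g =>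
    Finset.sum_comm.trans (Finset.sum_congr rfl fun H _ => Finset.sum_comm)
  rw [hswap, hswap]
  refine Finset.sum_congr rfl fun H _ => ?_
  refine Finset.sum_congr rfl fun v _ => ?_
  rw [← Finset.sum_filter_add_sum_filter_not Finset.univ (fun F : Finset V => v ∈ F),
    ← Finset.sum_filter_add_sum_filter_not Finset.univ (fun F : Finset V => v ∈ F)]
  have h0 : ∑ F : Finset V with v ∈ F, sgn R v H *
      (ψ F (insert v H) * (x v * φ F H + φ (insert v F) H)) = 0 :=
    Finset.sum_eq_zero fun F hF => by
      rw [hψ' (by simpa using hF)]; simp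
  have h1 := sum_filter_notMem_eq_sum_filter_mem v fun F =>
    sgn R v H * (ψ F (insert v H) * φ (insert v F) H)
  rw [h0, zero_add]
  simp only [mul_add, Finset.sum_add_distrib]
  rw [h1, add_comm]
  congr 1
  · refine Finset.sum_congr rfl fun F hF => ?_
    rw [if_neg (by simpa using hF)]; ring
  · refine Finset.sum_congr rfl fun F hF => ?_
    have hF : v ∈ F := by simpa using hF
    rw [if_pos hF, Finset.insert_erase hF]; ring

end Resolution

end SerrePaper

namespace SerrePaper

section Exactness

variable {V : Type} [LinearOrder V] {R : Type} [CommRing R] {x : V → R}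

/-- Induction on simplicial complexes, by adding one facet at a time. -/
lemma finset_complex_induction
    {p : (K : Finset (Finset V)) → (∀ F ∈ K, ∀ G ⊆ F, G ∈ K) → Prop} (h0 : ∀ h, p ∅ h)
    (h1 : ∀ (K : Finset (Finset V)) (F : Finset V) (_ : F ∈ K)
      (hK : ∀ F ∈ K, ∀ G ⊆ F, G ∈ K) (_ : ∀ G ∈ K, F ⊆ G → G = F)
      (hK' : ∀ G ∈ K.erase F, ∀ H ⊆ G, H ∈ K.erase F), p (K.erase F) hK' → p K hK)
    (K : Finset (Finset V)) (hK : ∀ F ∈ K, ∀ G ⊆ F, G ∈ K) : p K hK := by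
  induction K using Finset.strongInduction with
  | H K ih =>
    obtain rfl | hne := K.eq_empty_or_nonempty
    · exact h0 _
    · obtain ⟨F, hF, hmax⟩ := K.exists_max_image Finset.card hne
      have hfacet : ∀ G ∈ K, F ⊆ G → G = F := fun G hG hFG =>
        (Finset.eq_of_subset_of_card_le hFG (hmax G hG)).symm
      refine h1 K F hF hK hfacet (fun F' hF' G hG => ?_) (ih _ (Finset.erase_ssubset hF) _)
      rw [Finset.mem_erase] at hF' ⊢
      refine ⟨?_, hK _ hF'.2 _ hG⟩
      rintro rfl
      exact hF'.1 (hfacet _ hF'.2 hG)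

variable [Fintype V]

/-- Cochains of degree `m` supported on `K` that are cocycles, and whose components at the pairs
`(F, Fᶜ)` vanish modulo the variables outside `F`, are coboundaries. -/
theorem RegularSubsets.exists_codiff_eq (hx : RegularSubsets x) (m : ℕ) (K : Finset (Finset V))
    (hK : ∀ F ∈ K, ∀ G ⊆ F, G ∈ K) (φ : Finset V → Finset V → R)
    (hsupp : ∀ F H, Disjoint F H → F ∉ K → φ F H = 0)
    (hm : ∀ F H, Disjoint F H → H.card ≠ m → φ F H = 0)
    (hφ : ∀ F H, Disjoint F H → codiff x φ F H = 0)
    (htop : ∀ F ∈ K, φ F Fᶜ ∈ Ideal.span (x '' (Fᶜ : Finset V))) :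
    ∃ ψ : Finset V → Finset V → R, (∀ F H, F ∉ K → ψ F H = 0) ∧
      (∀ F H, H.card + 1 ≠ m → ψ F H = 0) ∧ (∀ F, ψ F Fᶜ = 0) ∧
      ∀ F H, Disjoint F H → φ F H = codiff x ψ F H := by
  induction K, hK using finset_complex_induction generalizing φ with
  | h0 _ =>
    refine ⟨fun _ _ => 0, by simp, by simp, by simp, fun F H h => ?_⟩
    rw [hsupp F H h (by simp)]; simp [codiff]
  | h1 K F hF hK hmax _ ih =>
    obtain ⟨ψF, hψm, hψtop, hψF⟩ := hx.exists_koszul_eq Fᶜ m (φ F)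
      (fun G hG hGm => hm F G (Finset.disjoint_left.2 fun v hv hv' => by simpa [hv] using hG hv')
        hGm) (fun G hG => by
        have hd : Disjoint F G :=
          Finset.disjoint_left.2 fun v hv hv' => by simpa [hv] using hG hv'
        rw [← hφ F G hd]
        refine Finset.sum_congr rfl fun v hv => ?_
        rw [hsupp (insert v F) (G.erase v), add_zero]
        · simp [hd.mono_right (Finset.erase_subset v G)]
        · intro hvF
          have := hmax _ hvF (Finset.subset_insert _ _)
          rw [Finset.insert_eq_self] at this
          exact Finset.disjoint_left.1 hd this hv) (htop F hF)
    let σ : Finset V → Finset V → R := fun F' H => if F' = F then ψF H else 0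
    have hσF : ∀ H, Disjoint F H → codiff x σ F H = φ F H := fun H hd => by
      rw [hψF H (fun v hv => by
        rw [Finset.mem_compl]; exact Finset.disjoint_right.1 hd hv)]
      refine Finset.sum_congr rfl fun v hv => ?_
      have hvF : insert v F ≠ F := by
        rw [ne_eq, Finset.insert_eq_self]; exact Finset.disjoint_right.1 hd hv
      simp [σ, hvF]
    have hσK : ∀ F' H, F' ∉ K → Disjoint F' H → codiff x σ F' H = 0 := fun F' H hF' _ => by
      refine Finset.sum_eq_zero fun v _ => ?_
      have h1 : F' ≠ F := by rintro rfl; exact hF' hF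
      have h2 : insert v F' ≠ F := by
        rintro rfl; exact hF' (hK _ hF _ (Finset.subset_insert _ _))
      simp [σ, h1, h2]
    obtain ⟨ψ, h1, h2, h3, h4⟩ := ih (fun F' H => φ F' H - codiff x σ F' H)
      (fun F' H hd hF' => by
        rw [Finset.mem_erase, not_and_or, not_not] at hF'
        rcases hF' with rfl | hF'
        · rw [hσF H hd, sub_self]
        · rw [hsupp F' H hd hF', hσK F' H hF' hd, sub_self])
      (fun F' H hd hH => by
        rw [hm F' H hd hH, zero_sub, neg_eq_zero]
        refine Finset.sum_eq_zero fun v hv => ?_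
        have : ψF (H.erase v) = 0 := hψm _ (by rwa [Finset.card_erase_add_one hv])
        simp [σ, this])
      (fun F' H hd => by rw [codiff_sub, hφ F' H hd, codiff_codiff, sub_self])
      (fun F' hF' => by
        rw [Finset.mem_erase] at hF'
        refine sub_mem (htop F' hF'.2) (Ideal.sum_mem _ fun v hv => Ideal.mul_mem_left _ _ ?_)
        have : σ (insert v F') (F'ᶜ.erase v) = 0 := by
          simp only [σ]
          split_ifs with h
          · have : F'ᶜ.erase v = Fᶜ := by rw [← h, Finset.compl_insert]
            rw [this, hψtop]
          · rfl
        rw [this, add_zero]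
        exact Ideal.mul_mem_right _ _ (Ideal.subset_span ⟨v, hv, rfl⟩))
    refine ⟨fun F' H => ψ F' H + σ F' H, fun F' H hF' => ?_, fun F' H hH => ?_, fun F' => ?_,
      fun F' H hd => ?_⟩
    · have : F' ≠ F := by rintro rfl; exact hF' hF
      beta_reduce
      rw [h1 F' H (fun h => hF' (Finset.mem_of_mem_erase h))]
      simp [σ, this]
    · beta_reduce
      rw [h2 F' H hH, zero_add]
      simp only [σ]; split_ifs
      · exact hψm _ hH
      · rfl
    · beta_reduce
      rw [h3, zero_add]
      simp only [σ]; split_ifs with h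
      · rw [h]; exact hψtop
      · rfl
    · rw [codiff_add, ← h4 F' H hd]; ring

/-- The part of the augmentation of the resolution seen by the face `F`. -/
def augAt (x : V → R) (φ : Finset V → Finset V → R) (F : Finset V) : R :=
  ∑ G ∈ F.powerset, (-1) ^ G.card * (∏ v ∈ G, x v) * φ G ∅

lemma augAt_diff_mem (ψ : Finset V → Finset V → R) (F : Finset V) :
    augAt x (diff x ψ) F ∈ Ideal.span (x '' (Fᶜ : Finset V)) := by
  have : augAt x (diff x ψ) F = ∑ v : V, ∑ G ∈ F.powerset, (-1) ^ G.card * (∏ v ∈ G, x v) *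
      if v ∈ G then ψ (G.erase v) {v} else x v * ψ G {v} := by
    rw [Finset.sum_comm]
    refine Finset.sum_congr rfl fun G _ => ?_
    simp [diff, sgn, Finset.mul_sum]
  rw [this]
  refine Ideal.sum_mem _ fun v _ => ?_
  by_cases hv : v ∈ F
  · convert Ideal.zero_mem _
    rw [← Finset.insert_erase hv, Finset.sum_powerset_insert (Finset.notMem_erase _ _),
      ← Finset.sum_add_distrib]
    refine Finset.sum_eq_zero fun G hG => ?_
    have hvG : v ∉ G := fun h => Finset.notMem_erase v F (Finset.mem_powerset.1 hG h)
    simp only [hvG, if_false, Finset.mem_insert_self, if_true, Finset.erase_insert hvG,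
      Finset.card_insert_of_notMem hvG, Finset.prod_insert hvG, pow_succ]
    ring
  · refine Ideal.sum_mem _ fun G hG => Ideal.mul_mem_left _ _ ?_
    rw [if_neg fun h => hv (Finset.mem_powerset.1 hG h)]
    exact Ideal.mul_mem_right _ _ (Ideal.subset_span ⟨v, by simpa using hv, rfl⟩)

lemma koszul_sdiff_eq_diff (W F : Finset V) (hW : W = Fᶜ) (χ : Finset V → R) (G : Finset V)
    (hG : G ⊆ W) (φ : Finset V → Finset V → R) (hφ : ∀ v ∈ F, ∀ H, φ (F.erase v) H = 0)
    (hφF : ∀ H ⊆ W, φ F H = χ (W \ H)) :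
    koszul (fun v => sgn R v W * x v) χ G = diff x φ F (W \ G) := by
  have hsub : G ⊆ (W \ G)ᶜ := fun v hv => by simp [hv]
  rw [koszul, diff]
  rw [← Finset.sum_subset hsub]
  · refine Finset.sum_congr rfl fun v hv => ?_
    have hvF : v ∉ F := by rw [← Finset.mem_compl, ← hW]; exact hG hv
    have hvW := hG hv
    rw [if_neg hvF, hφF _ (Finset.insert_subset hvW Finset.sdiff_subset)]
    have h1 : W \ insert v (W \ G) = G.erase v := by
      ext u
      simp only [Finset.mem_sdiff, Finset.mem_insert, Finset.mem_erase]
      constructor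
      · rintro ⟨h1, h2⟩; push Not at h2; exact ⟨h2.1, by tauto⟩
      · rintro ⟨h1, h2⟩; exact ⟨hG h2, by tauto⟩
    have h2 : sgn R v W = sgn R v G * sgn R v (W \ G) := by
      rw [← sgn_union_of_disjoint Finset.disjoint_sdiff, Finset.union_sdiff_of_subset hG]
    rw [h1, h2]
    linear_combination (sgn R v (W \ G) * x v * χ (G.erase v)) * sgn_mul_self (R := R) v G
  · intro v hv hvG
    have hvF : v ∈ F := by
      subst hW
      simp only [Finset.mem_compl, Finset.mem_sdiff, not_and_or, not_not] at hv
      tauto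
    rw [if_pos hvF, hφ v hvF _, mul_zero]

/-- Acyclicity of the resolution. -/
theorem RegularSubsets.exists_diff_eq (hx : RegularSubsets x) (i : ℕ) (K : Finset (Finset V))
    (hK : ∀ F ∈ K, ∀ G ⊆ F, G ∈ K) (φ : Finset V → Finset V → R)
    (hi : ∀ F H, Disjoint F H → H.card ≠ i → φ F H = 0)
    (hφ : ∀ F ∈ K, ∀ H, Disjoint F H → diff x φ F H = 0)
    (haug : i = 0 → ∀ F ∈ K, augAt x φ F ∈ Ideal.span (x '' (Fᶜ : Finset V))) :
    ∃ ψ : Finset V → Finset V → R, (∀ F H, H.card ≠ i + 1 → ψ F H = 0) ∧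
      ∀ F ∈ K, ∀ H, Disjoint F H → φ F H = diff x ψ F H := by
  induction K, hK using finset_complex_induction generalizing φ with
  | h0 _ => exact ⟨fun _ _ => 0, by simp, by simp⟩
  | h1 K F hF hK hmax _ ih =>
    obtain ⟨ψ, hψi, hψ⟩ := ih φ hi (fun F hF => hφ F (Finset.mem_of_mem_erase hF))
      (fun h F hF => haug h F (Finset.mem_of_mem_erase hF))
    have hdi : ∀ F H, H.card ≠ i → diff x ψ F H = 0 := fun F H hH => by
      refine Finset.sum_eq_zero fun v hv => ?_
      have : (insert v H).card ≠ i + 1 := by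
        rw [Finset.card_insert_of_notMem (Finset.mem_compl.1 hv)]; omega
      rw [hψi _ _ this, hψi _ _ this]; simp
    let φ' : Finset V → Finset V → R := fun F' H => φ F' H - diff x ψ F' H
    have hmem : ∀ G ⊂ F, G ∈ K.erase F := fun G hG =>
      Finset.mem_erase.2 ⟨hG.ne, hK _ hF _ hG.subset⟩
    have hφ'0 : ∀ G ⊂ F, ∀ H, Disjoint G H → φ' G H = 0 := fun G hG H hd => by
      simp only [φ']; rw [hψ G (hmem G hG) H hd, sub_self]
    have hφ'i : ∀ F H, Disjoint F H → H.card ≠ i → φ' F H = 0 := fun F H hd hH => by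
      simp only [φ']; rw [hi F H hd hH, hdi F H hH, sub_self]
    have htop : φ' F ∅ ∈ Ideal.span (x '' (Fᶜ : Finset V)) := by
      by_cases h0 : i = 0
      · have h1 : augAt x φ' F ∈ Ideal.span (x '' (Fᶜ : Finset V)) := by
          have : augAt x φ' F = augAt x φ F - augAt x (diff x ψ) F := by
            simp only [augAt, φ', mul_sub, Finset.sum_sub_distrib]
          rw [this]; exact sub_mem (haug h0 F hF) (augAt_diff_mem ψ F)
        have h2 : augAt x φ' F = (-1) ^ F.card * (∏ v ∈ F, x v) * φ' F ∅ := by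
          refine Finset.sum_eq_single_of_mem F (by simp) fun G hG hGF => ?_
          rw [hφ'0 G (lt_of_le_of_ne (Finset.mem_powerset.1 hG) hGF) ∅ (by simp), mul_zero]
        refine hx.of_prod_mul_mem _ F disjoint_compl_right _ ?_
        have h3 := Ideal.mul_mem_left _ ((-1 : R) ^ F.card) h1
        rwa [h2, mul_assoc, ← mul_assoc, ← mul_pow, neg_one_mul, neg_neg, one_pow, one_mul] at h3
      · rw [hφ'i F ∅ (by simp) (by simpa using Ne.symm h0)]; exact zero_mem _
    obtain ⟨W, hW⟩ : ∃ W, W = Fᶜ := ⟨_, rfl⟩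
    have hdisj : ∀ H, H ⊆ W ↔ Disjoint F H := fun H => by
      rw [hW]; exact le_compl_iff_disjoint_left
    let φ'' : Finset V → Finset V → R := fun F' H => if F' = F then φ' F H else 0
    have hker : ∀ H, Disjoint F H → diff x φ'' F H = 0 := fun H hd => by
      have : diff x φ'' F H = diff x φ' F H := by
        refine diff_congr x hd fun F' H' hd' hF' _ => ?_
        simp only [φ'']
        split_ifs with h
        · rw [h]
        · rw [hφ'0 F' (lt_of_le_of_ne hF' h) H' hd']
      rw [this]; simp only [φ']; rw [diff_sub, hφ F hF H hd, diff_diff, sub_self]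
    have herase : ∀ v ∈ F, F.erase v ≠ F := fun v hv h =>
      Finset.notMem_erase v F (h.symm ▸ hv)
    obtain ⟨χ, hχm, -, hχ⟩ := (hx.sign_mul (fun v => sgn R v W)
        (fun v => sgn_mul_self v W)).exists_koszul_eq W (W.card - i)
      (fun G => φ' F (W \ G))
      (fun G hG hGi => hφ'i F _ ((hdisj _).1 Finset.sdiff_subset) fun h => hGi (by
        rw [Finset.card_sdiff_of_subset hG] at h
        have := Finset.card_le_card hG
        omega))
      (fun G hG => by
        rw [koszul_sdiff_eq_diff (x := x) W F hW _ G hG φ'']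
        · exact hker _ ((hdisj _).1 Finset.sdiff_subset)
        · intro v hv H; simp [φ'', herase v hv]
        · intro H hH; simp [φ'', Finset.inter_eq_right.2 hH])
      (by
        rw [span_image_sign_mul x _ (fun v => sgn_mul_self v W)]
        simpa [hW] using htop)
    let σ : Finset V → Finset V → R := fun F' H =>
      if F' = F then (if H.card = i + 1 then χ (W \ H) else 0) else 0
    let σ' : Finset V → Finset V → R := fun F' H => if F' = F then χ (W \ H) else 0
    have hσF : ∀ H, Disjoint F H → diff x σ F H = φ' F H := fun H hd => by
      by_cases hH : H.card = i
      · have h1 := hχ (W \ H) Finset.sdiff_subset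
        have hWH : W \ (W \ H) = H := by simp [Finset.inter_eq_right.2 ((hdisj H).2 hd)]
        rw [koszul_sdiff_eq_diff (x := x) W F hW χ _ Finset.sdiff_subset σ'
          (by intro v hv H; simp [σ', herase v hv]) (by intro H _; simp [σ']), hWH] at h1
        rw [h1]
        refine diff_congr x hd fun F' H' _ _ hc => ?_
        simp [σ, σ', hc, hH]
      · rw [hφ'i F H hd hH]
        refine Finset.sum_eq_zero fun v hv => ?_
        have : (insert v H).card ≠ i + 1 := by
          rw [Finset.card_insert_of_notMem (Finset.mem_compl.1 hv)]; omega
        simp [σ, this]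
    refine ⟨fun F' H => ψ F' H + σ F' H, fun F' H hH => ?_, fun F' hF' H hd => ?_⟩
    · beta_reduce
      rw [hψi F' H hH]; simp [σ, hH]
    · rw [diff_add]
      by_cases h : F' = F
      · subst h
        rw [hσF H hd]; simp only [φ']; ring
      · have : diff x σ F' H = 0 := by
          refine Finset.sum_eq_zero fun v _ => ?_
          have h2 : F'.erase v ≠ F := by
            rintro rfl; exact h (hmax _ hF' (Finset.erase_subset _ _))
          simp [σ, h, h2]
        rw [this, add_zero]
        exact hψ F' (Finset.mem_erase.2 ⟨h, hF'⟩) H hd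

end Exactness

end SerrePaper

namespace SerrePaper

section ExtOfResolution

variable {R : Type} [CommRing R]

lemma mem_annihilator_homology_iff (S : ShortComplex (ModuleCat.{0} R)) (a : R) :
    a ∈ Module.annihilator R S.homology ↔
      ∀ z : S.X₂, S.g.hom z = 0 → ∃ b : S.X₁, S.f.hom b = a • z := by
  rw [S.moduleCatHomologyIso.toLinearEquiv.annihilator_eq, Module.mem_annihilator]
  change (∀ y : LinearMap.ker S.g.hom ⧸ LinearMap.range S.moduleCatToCycles, a • y = 0) ↔ _
  constructor
  · intro h z hz
    have h1 := h (Submodule.Quotient.mk ⟨z, hz⟩)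
    rw [← Submodule.Quotient.mk_smul, Submodule.Quotient.mk_eq_zero] at h1
    obtain ⟨b, hb⟩ := h1
    exact ⟨b, congrArg Subtype.val hb⟩
  · intro h y
    obtain ⟨⟨z, hz⟩, rfl⟩ := Submodule.Quotient.mk_surjective _ y
    obtain ⟨b, hb⟩ := h z hz
    rw [← Submodule.Quotient.mk_smul, Submodule.Quotient.mk_eq_zero]
    exact ⟨b, Subtype.ext hb⟩

variable {P : ℕ → Type} [∀ i, AddCommGroup (P i)] [∀ i, Module R (P i)]
  {M : Type} [AddCommGroup M] [Module R M]
  (d : ∀ i, P (i + 1) →ₗ[R] P i) (ε : P 0 →ₗ[R] M)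

/-- The chain complex with the given differentials. -/
def chainComplexOf (hdd : ∀ i, Function.Exact (d (i + 1)) (d i)) :
    ChainComplex (ModuleCat.{0} R) ℕ :=
  ChainComplex.of (fun i => ModuleCat.of R (P i)) (fun i => ModuleCat.ofHom (d i))
    (fun i => by
      ext x
      exact (hdd i).apply_apply_eq_zero x)

lemma chainComplexOf_d (hdd : ∀ i, Function.Exact (d (i + 1)) (d i)) (i : ℕ) :
    (chainComplexOf d hdd).d (i + 1) i = ModuleCat.ofHom (d i) :=
  ChainComplex.of_d (fun i => ModuleCat.of R (P i)) (fun i => ModuleCat.ofHom (d i)) i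

/-- The augmentation of `chainComplexOf`, as a morphism of complexes. -/
noncomputable def augmentationOf (hdd : ∀ i, Function.Exact (d (i + 1)) (d i))
    (hdε : Function.Exact (d 0) ε) :
    chainComplexOf d hdd ⟶ (ChainComplex.single₀ _).obj (ModuleCat.of R M) :=
  (ChainComplex.toSingle₀Equiv _ _).symm ⟨ModuleCat.ofHom ε, by
    rw [chainComplexOf_d]
    ext x
    exact hdε.apply_apply_eq_zero x⟩

lemma augmentationOf_f_zero (hdd : ∀ i, Function.Exact (d (i + 1)) (d i))
    (hdε : Function.Exact (d 0) ε) :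
    (augmentationOf d ε hdd hdε).f 0 = ModuleCat.ofHom ε :=
  ChainComplex.toSingle₀Equiv_symm_apply_f_zero _ _

variable [∀ i, Module.Projective R (P i)]

/-- The projective resolution with the given differentials. -/
noncomputable def projectiveResolutionOf (hdd : ∀ i, Function.Exact (d (i + 1)) (d i))
    (hdε : Function.Exact (d 0) ε) (hε : Function.Surjective ε) :
    ProjectiveResolution (ModuleCat.of R M) where
  complex := chainComplexOf d hdd
  projective i := inferInstanceAs (Projective (ModuleCat.of R (P i)))
  π := augmentationOf d ε hdd hdε
  quasiIso := ⟨fun n => by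
    cases n with
    | zero =>
      rw [ChainComplex.quasiIsoAt₀_iff, ShortComplex.quasiIso_iff_of_zeros' _ rfl rfl rfl]
      constructor
      · rw [ShortComplex.moduleCat_exact_iff]
        intro x hx
        have hx' : (augmentationOf d ε hdd hdε).f 0 x = 0 := hx
        rw [augmentationOf_f_zero] at hx'
        obtain ⟨y, hy⟩ := (hdε x).1 hx'
        have hy' : (chainComplexOf d hdd).d 1 0 y = x := by
          rw [chainComplexOf_d]; exact hy
        exact ⟨y, hy'⟩
      · rw [ModuleCat.epi_iff_surjective]
        change Function.Surjective ((augmentationOf d ε hdd hdε).f 0)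
        rw [augmentationOf_f_zero]
        exact hε
    | succ n =>
      rw [quasiIsoAt_iff_exactAt' (hL := ChainComplex.exactAt_succ_single_obj ..),
          HomologicalComplex.exactAt_iff' _ (n + 2) (n + 1) n (by simp) (by simp),
          ShortComplex.moduleCat_exact_iff]
      intro x hx
      have hx' : (chainComplexOf d hdd).d (n + 1) n x = 0 := hx
      rw [chainComplexOf_d] at hx'
      obtain ⟨y, hy⟩ := (hdd n x).1 hx'
      have hy' : (chainComplexOf d hdd).d (n + 2) (n + 1) y = x := by
        rw [chainComplexOf_d]; exact hy
      exact ⟨y, hy'⟩⟩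

lemma mem_annihilator_extM_iff (hdd : ∀ i, Function.Exact (d (i + 1)) (d i))
    (hdε : Function.Exact (d 0) ε) (hε : Function.Surjective ε) (a : R) (l m : ℕ)
    (hl : (ComplexShape.up ℕ).prev m = l) :
    a ∈ Module.annihilator R (extM (ModuleCat.of R M) (ModuleCat.of R R) m) ↔
      ∀ f : (chainComplexOf d hdd).X m ⟶ ModuleCat.of R R,
        (chainComplexOf d hdd).d (m + 1) m ≫ f = 0 →
        ∃ g : (chainComplexOf d hdd).X l ⟶ ModuleCat.of R R,
          (chainComplexOf d hdd).d m l ≫ g = a • f := by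
  rw [extM, (((projectiveResolutionOf d ε hdd hdε hε).isoExt m _).toLinearEquiv.annihilator_eq),
    HomologicalComplex.homology,
    (ShortComplex.homologyMapIso (HomologicalComplex.isoSc' _ l m (m + 1) hl
      (CochainComplex.next ℕ m))).toLinearEquiv.annihilator_eq, mem_annihilator_homology_iff]
  rfl

theorem mem_annihilator_extM_zero_iff (hdd : ∀ i, Function.Exact (d (i + 1)) (d i))
    (hdε : Function.Exact (d 0) ε) (hε : Function.Surjective ε) (a : R) :
    a ∈ Module.annihilator R (extM (ModuleCat.of R M) (ModuleCat.of R R) 0) ↔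
      ∀ f : P 0 →ₗ[R] R, f ∘ₗ d 0 = 0 → a • f = 0 := by
  rw [mem_annihilator_extM_iff d ε hdd hdε hε a 0 0 CochainComplex.prev_nat_zero,
    chainComplexOf_d, HomologicalComplex.shape _ _ _ (by simp)]
  constructor
  · intro h f hf
    obtain ⟨g, hg⟩ := h (ModuleCat.ofHom f) (ModuleCat.hom_ext hf)
    rw [Limits.zero_comp] at hg
    exact (congrArg ModuleCat.Hom.hom hg).symm
  · intro h f hf
    have := h f.hom (congrArg ModuleCat.Hom.hom hf)
    refine ⟨0, ?_⟩
    rw [Limits.comp_zero]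
    exact ModuleCat.hom_ext this.symm

theorem mem_annihilator_extM_succ_iff (hdd : ∀ i, Function.Exact (d (i + 1)) (d i))
    (hdε : Function.Exact (d 0) ε) (hε : Function.Surjective ε) (a : R) (m : ℕ) :
    a ∈ Module.annihilator R (extM (ModuleCat.of R M) (ModuleCat.of R R) (m + 1)) ↔
      ∀ f : P (m + 1) →ₗ[R] R, f ∘ₗ d (m + 1) = 0 → ∃ g : P m →ₗ[R] R, g ∘ₗ d m = a • f := by
  rw [mem_annihilator_extM_iff d ε hdd hdε hε a m (m + 1) (CochainComplex.prev_nat_succ m),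
    chainComplexOf_d, chainComplexOf_d]
  constructor
  · intro h f hf
    obtain ⟨g, hg⟩ := h (ModuleCat.ofHom f) (ModuleCat.hom_ext hf)
    exact ⟨g.hom, congrArg ModuleCat.Hom.hom hg⟩
  · intro h f hf
    obtain ⟨g, hg⟩ := h f.hom (congrArg ModuleCat.Hom.hom hf)
    exact ⟨ModuleCat.ofHom g, ModuleCat.hom_ext hg⟩

end ExtOfResolution

end SerrePaper

namespace SerrePaper

section Resolution

variable {V : Type} [LinearOrder V] {R : Type} [CommRing R] (x : V → R)
  (K : Set (Finset V))

/-- The basis of the `i`-th module of the resolution of the Stanley–Reisner ring. -/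
abbrev ResIndex (i : ℕ) : Type :=
  {p : Finset V × Finset V // p.1 ∈ K ∧ Disjoint p.1 p.2 ∧ p.2.card = i}

variable {K}

open Classical in
/-- Extension by zero. -/
noncomputable def extend {i : ℕ} (f : ResIndex K i → R) (F H : Finset V) : R :=
  if h : F ∈ K ∧ Disjoint F H ∧ H.card = i then f ⟨(F, H), h⟩ else 0

lemma extend_of_mem {i : ℕ} (f : ResIndex K i → R) {F H : Finset V}
    (h : F ∈ K ∧ Disjoint F H ∧ H.card = i) : extend f F H = f ⟨(F, H), h⟩ :=
  dif_pos h

lemma extend_of_notMem {i : ℕ} (f : ResIndex K i → R) {F H : Finset V}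
    (h : ¬ (F ∈ K ∧ Disjoint F H ∧ H.card = i)) : extend f F H = 0 :=
  dif_neg h

lemma extend_add {i : ℕ} (f g : ResIndex K i → R) (F H : Finset V) :
    extend (f + g) F H = extend f F H + extend g F H := by
  unfold extend; split_ifs <;> simp

lemma extend_smul {i : ℕ} (a : R) (f : ResIndex K i → R) (F H : Finset V) :
    extend (a • f) F H = a * extend f F H := by
  unfold extend; split_ifs <;> simp

variable [Fintype V] (K)

/-- The differential of the resolution. -/
noncomputable def resD (i : ℕ) : (ResIndex K (i + 1) → R) →ₗ[R] (ResIndex K i → R) where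
  toFun f p := diff x (extend f) p.1.1 p.1.2
  map_add' f g := by
    ext p
    rw [Pi.add_apply, ← diff_add]
    exact diff_congr x p.2.2.1 fun _ _ _ _ _ => extend_add f g _ _
  map_smul' a f := by
    ext p
    rw [RingHom.id_apply, Pi.smul_apply, smul_eq_mul, ← diff_smul]
    exact diff_congr x p.2.2.1 fun _ _ _ _ _ => extend_smul a f _ _

lemma resD_apply (i : ℕ) (f : ResIndex K (i + 1) → R) (p : ResIndex K i) :
    resD x K i f p = diff x (extend f) p.1.1 p.1.2 := rfl

variable {x K}

lemma diff_eq_zero_of_card_ne {i : ℕ} {ψ : Finset V → Finset V → R} {F H : Finset V}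
    (hFH : Disjoint F H) (hψ : ∀ F H, Disjoint F H → H.card ≠ i + 1 → ψ F H = 0)
    (hH : H.card ≠ i) : diff x ψ F H = 0 := by
  rw [diff_congr (ψ := fun _ _ => 0) x hFH fun F' H' hd _ hc => hψ F' H' hd (by omega)]
  simp [diff]

theorem resD_exact (hx : RegularSubsets x) (hK : IsComplex K) (i : ℕ) :
    Function.Exact (resD x K (i + 1)) (resD x K i) := by
  intro f
  constructor
  · intro hf
    obtain ⟨ψ, h1, h2⟩ := hx.exists_diff_eq (i + 1) (Set.toFinite K).toFinset
      (by simpa using hK.2) (extend f)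
      (fun F H _ hH => extend_of_notMem f fun h => hH h.2.2)
      (fun F hF H hd => by
        by_cases hH : H.card = i
        · exact congrFun hf ⟨(F, H), by simpa using hF, hd, hH⟩
        · exact diff_eq_zero_of_card_ne hd
            (fun F H _ hH => extend_of_notMem f fun h => hH h.2.2) hH) (by simp)
    refine ⟨fun p => ψ p.1.1 p.1.2, funext fun p => ?_⟩
    obtain ⟨⟨F, H⟩, hp⟩ := p
    rw [resD_apply, ← extend_of_mem f hp, h2 F (by simpa using hp.1) H hp.2.1]
    refine diff_congr x hp.2.1 fun F' H' hd hF' hc => ?_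
    rw [extend_of_mem _ ⟨hK.2 _ hp.1 _ hF', hd, by rw [hc, hp.2.2]⟩]
  · rintro ⟨g, rfl⟩
    funext ⟨⟨F, H⟩, hp⟩
    rw [resD_apply, Pi.zero_apply, ← diff_diff x (extend g) F H]
    refine diff_congr x hp.2.1 fun F' H' hd hF' hc => ?_
    rw [extend_of_mem _ ⟨hK.2 _ hp.1 _ hF', hd, by rw [hc, hp.2.2]⟩, resD_apply]

/-- The linear form on the `m`-th module of the resolution with given values on the basis. -/
noncomputable def cochainForm (K : Set (Finset V)) (m : ℕ) (φ : Finset V → Finset V → R) :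
    (ResIndex K m → R) →ₗ[R] R where
  toFun g := ∑ F : Finset V, ∑ H : Finset V, extend g F H * φ F H
  map_add' f g := by simp only [extend_add, add_mul, Finset.sum_add_distrib]
  map_smul' a f := by simp only [extend_smul, mul_assoc, Finset.mul_sum, RingHom.id_apply,
    smul_eq_mul]

lemma cochainForm_single {m : ℕ} (φ : Finset V → Finset V → R) (p : ResIndex K m) :
    cochainForm K m φ (Pi.single p 1) = φ p.1.1 p.1.2 := by
  have : ∀ F H : Finset V, extend (Pi.single p (1 : R) : ResIndex K m → R) F H =
      if F = p.1.1 then (if H = p.1.2 then 1 else 0) else 0 := by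
    intro F H
    by_cases h : F ∈ K ∧ Disjoint F H ∧ H.card = m
    · rw [extend_of_mem _ h, Pi.single_apply, ← ite_and]
      refine if_congr ?_ rfl rfl
      rw [Subtype.ext_iff, Prod.ext_iff]
    · rw [extend_of_notMem _ h, ← ite_and, if_neg]
      rintro ⟨rfl, rfl⟩
      exact h p.2
  change ∑ F : Finset V, ∑ H : Finset V, _ * φ F H = _
  simp [this]

lemma eq_cochainForm {m : ℕ} (f : (ResIndex K m → R) →ₗ[R] R) :
    f = cochainForm K m (extend fun p => f (Pi.single p 1)) := by
  refine LinearMap.pi_ext' fun p => LinearMap.ext_ring ?_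
  simp only [LinearMap.comp_apply, LinearMap.single_apply]
  rw [cochainForm_single, extend_of_mem _ p.2]

lemma cochainForm_eq_iff {m : ℕ} {φ ψ : Finset V → Finset V → R} :
    cochainForm K m φ = cochainForm K m ψ ↔
      ∀ F ∈ K, ∀ H, Disjoint F H → H.card = m → φ F H = ψ F H := by
  constructor
  · intro h F hF H hd hH
    have := LinearMap.congr_fun h (Pi.single ⟨(F, H), hF, hd, hH⟩ 1)
    rwa [cochainForm_single, cochainForm_single] at this
  · intro h
    refine LinearMap.pi_ext' fun p => LinearMap.ext_ring ?_
    simp only [LinearMap.comp_apply, LinearMap.single_apply]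
    rw [cochainForm_single, cochainForm_single, h _ p.2.1 _ p.2.2.1 p.2.2.2]

lemma cochainForm_comp_resD {m : ℕ} {φ : Finset V → Finset V → R}
    (hφ : ∀ F H, Disjoint F H → F ∉ K → φ F H = 0) :
    cochainForm K m φ ∘ₗ resD x K m = cochainForm K (m + 1) (codiff x φ) := by
  let φ' : Finset V → Finset V → R := extend fun p : ResIndex K m => φ p.1.1 p.1.2
  have h1 : cochainForm K m φ = cochainForm K m φ' := cochainForm_eq_iff.2
    fun F hF H hd hH => by simp only [φ']; rw [extend_of_mem _ ⟨hF, hd, hH⟩]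
  have h2 : cochainForm K (m + 1) (codiff x φ) = cochainForm K (m + 1) (codiff x φ') :=
    cochainForm_eq_iff.2 fun F hF H hd hH => codiff_congr x hd fun F' H' hd' _ hc => by
      simp only [φ']
      by_cases hF' : F' ∈ K
      · rw [extend_of_mem _ ⟨hF', hd', by omega⟩]
      · rw [hφ _ _ hd' hF', extend_of_notMem _ fun h => hF' h.1]
  rw [h1, h2]
  refine LinearMap.ext fun g => ?_
  rw [LinearMap.comp_apply]
  change ∑ F : Finset V, ∑ H : Finset V, _ = ∑ F : Finset V, ∑ H : Finset V, _
  rw [← sum_diff_mul x φ' (extend g) fun F H h => extend_of_notMem g fun h' => h h'.2.1]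
  refine Finset.sum_congr rfl fun F _ => Finset.sum_congr rfl fun H _ => ?_
  by_cases h : F ∈ K ∧ Disjoint F H ∧ H.card = m
  · rw [extend_of_mem _ h, resD_apply]
  · simp only [φ']; rw [extend_of_notMem _ h, extend_of_notMem _ h, zero_mul, mul_zero]

end Resolution

end SerrePaper

namespace SerrePaper

section StanleyReisner

variable {V : Type} {k : Type} [Field k]

lemma notMem_span_X_of_eval {U : Finset V} {a : MvPolynomial V k} {m : V →₀ ℕ}
    (hm : m ∈ a.support) (hU : ∀ v ∈ U, m v = 0) :
    a ∉ Ideal.span ((X : V → MvPolynomial V k) '' (U : Set V)) := by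
  rw [mem_ideal_span_X_image]
  intro h
  obtain ⟨i, hi, hi'⟩ := h m hm
  exact hi' (hU i hi)

lemma regularSubsets_X [LinearOrder V] : RegularSubsets (X : V → MvPolynomial V k) := by
  intro U v hv a ha
  rw [mem_ideal_span_X_image] at ha ⊢
  intro m hm
  obtain ⟨i, hi, hi'⟩ := ha (Finsupp.single v 1 + m) (by
    rw [mem_support_iff] at hm ⊢
    rwa [mul_comm, add_comm, coeff_mul_X])
  refine ⟨i, hi, ?_⟩
  have : v ≠ i := by rintro rfl; exact hv hi
  simpa [Finsupp.single_apply, this] using hi'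

variable {K : Set (Finset V)}

lemma srIdeal_le_span_X [Fintype V] [DecidableEq V] (hK : IsComplex K) {F : Finset V}
    (hF : F ∈ K) :
    srIdeal k K ≤ Ideal.span ((X : V → MvPolynomial V k) '' (Fᶜ : Finset V)) := by
  rw [srIdeal, Ideal.span_le]
  rintro _ ⟨G, hG, rfl⟩
  have : ¬ G ⊆ F := fun h => hG (hK.2 F hF G h)
  obtain ⟨v, hvG, hvF⟩ := Finset.not_subset.1 this
  exact Ideal.mem_of_dvd _ (Finset.dvd_prod_of_mem _ hvG)
    (Ideal.subset_span ⟨v, by simpa using hvF, rfl⟩)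

variable [LinearOrder V]

lemma codiff_eq_zero_of_notMem {R : Type} [CommRing R] {x : V → R} (hK : IsComplex K)
    {φ : Finset V → Finset V → R} (hφ : ∀ F H, Disjoint F H → F ∉ K → φ F H = 0)
    {F H : Finset V} (hd : Disjoint F H) (hF : F ∉ K) : codiff x φ F H = 0 := by
  rw [codiff_congr (ψ := fun _ _ => 0) x hd fun F' H' hd' hFF' _ =>
    hφ F' H' hd' fun h => hF (hK.2 _ h _ hFF')]
  simp [codiff]

lemma codiff_eq_zero_of_card_ne {R : Type} [CommRing R] {x : V → R} {m : ℕ}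
    {φ : Finset V → Finset V → R} (hφ : ∀ F H, Disjoint F H → H.card ≠ m → φ F H = 0)
    {F H : Finset V} (hd : Disjoint F H) (hH : H.card ≠ m + 1) : codiff x φ F H = 0 := by
  rw [codiff_congr (ψ := fun _ _ => 0) x hd fun F' H' hd' _ hc => hφ F' H' hd' (by omega)]
  simp [codiff]

variable [Fintype V] (k K)

/-- The augmentation of the resolution of the Stanley–Reisner ring. -/
noncomputable def resAug :
    (ResIndex K 0 → MvPolynomial V k) →ₗ[MvPolynomial V k] (MvPolynomial V k ⧸ srIdeal k K) :=
  Submodule.mkQ _ ∘ₗ cochainForm K 0 fun F _ => (-1) ^ F.card * ∏ v ∈ F, X v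

variable {k K}

lemma resAug_surjective (hK : IsComplex K) : Function.Surjective (resAug k K) := by
  intro y
  obtain ⟨a, rfl⟩ := Submodule.Quotient.mk_surjective _ y
  have h0 : (∅ : Finset V) ∈ K := by
    obtain ⟨F, hF⟩ := hK.1
    exact hK.2 F hF ∅ (by simp)
  refine ⟨a • Pi.single ⟨(∅, ∅), h0, by simp, by simp⟩ 1, ?_⟩
  rw [map_smul, resAug, LinearMap.comp_apply, cochainForm_single]
  rw [← mul_one a, ← smul_eq_mul, Submodule.Quotient.mk_smul, smul_eq_mul, mul_one]
  simp only [Finset.card_empty, pow_zero, Finset.prod_empty, mul_one, Submodule.mkQ_apply]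

lemma resAug_eq_zero_iff (f : ResIndex K 0 → MvPolynomial V k) :
    resAug k K f = 0 ↔ ∑ F : Finset V, (-1) ^ F.card * (∏ v ∈ F, X v) * extend f F ∅ ∈
      srIdeal k K := by
  rw [resAug, LinearMap.comp_apply, Submodule.mkQ_apply, Submodule.Quotient.mk_eq_zero]
  refine iff_of_eq (congrArg (· ∈ srIdeal k K) ?_)
  refine Finset.sum_congr rfl fun F _ => ?_
  rw [Finset.sum_eq_single_of_mem ∅ (Finset.mem_univ _), mul_comm]
  intro H _ hH
  rw [extend_of_notMem _ (by simp [hH]), zero_mul]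

theorem resD_resAug_exact (hK : IsComplex K) :
    Function.Exact (resD (X : V → MvPolynomial V k) K 0) (resAug k K) := by
  intro f
  rw [resAug_eq_zero_iff]
  constructor
  · intro hf
    obtain ⟨ψ, h1, h2⟩ := (regularSubsets_X (k := k)).exists_diff_eq 0 (Set.toFinite K).toFinset
      (by simpa using hK.2) (extend f)
      (fun F H _ hH => extend_of_notMem f fun h => hH h.2.2)
      (fun F hF H hd => by
        rw [diff_congr (ψ := fun _ _ => 0) _ hd fun F' H' _ _ hc =>
          extend_of_notMem f fun h => by omega]
        simp [diff])
      (fun _ F hF => by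
        have h1 := srIdeal_le_span_X hK (by simpa using hF) hf
        rw [← Finset.sum_add_sum_compl F.powerset] at h1
        refine (Submodule.add_mem_iff_left _ (Ideal.sum_mem _ fun G hG => ?_)).1 h1
        rw [Finset.mem_compl, Finset.mem_powerset] at hG
        obtain ⟨v, hvG, hvF⟩ := Finset.not_subset.1 hG
        refine Ideal.mul_mem_right _ _ (Ideal.mul_mem_left _ _ (Ideal.mem_of_dvd _
          (Finset.dvd_prod_of_mem _ hvG) (Ideal.subset_span ⟨v, by simpa using hvF, rfl⟩))))
    refine ⟨fun p => ψ p.1.1 p.1.2, funext fun p => ?_⟩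
    obtain ⟨⟨F, H⟩, hp⟩ := p
    rw [resD_apply, ← extend_of_mem f hp, h2 F (by simpa using hp.1) H hp.2.1]
    refine diff_congr _ hp.2.1 fun F' H' hd hF' hc => ?_
    rw [extend_of_mem _ ⟨hK.2 _ hp.1 _ hF', hd, by rw [hc, hp.2.2]⟩]
  · rintro ⟨g, rfl⟩
    have h0 : augAt X (diff X (extend g)) Finset.univ = (0 : MvPolynomial V k) := by
      simpa using augAt_diff_mem (x := (X : V → MvPolynomial V k)) (extend g) Finset.univ
    rw [← sub_zero (∑ F : Finset V, _), ← h0, augAt, Finset.powerset_univ,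
      ← Finset.sum_sub_distrib]
    refine Ideal.sum_mem _ fun F _ => ?_
    by_cases hF : F ∈ K
    · rw [extend_of_mem _ ⟨hF, by simp, by simp⟩, resD_apply, sub_self]
      exact Ideal.zero_mem _
    · rw [← mul_sub, mul_assoc]
      exact Ideal.mul_mem_left _ _ (Ideal.mul_mem_right _ _ (Ideal.subset_span ⟨F, hF, rfl⟩))

lemma cochainForm_zero {R : Type} [CommRing R] (m : ℕ) :
    cochainForm K m (fun _ _ => (0 : R)) = 0 := by
  refine LinearMap.ext fun g => ?_
  change ∑ F : Finset V, ∑ H : Finset V, _ = 0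
  simp

lemma smul_cochainForm {R : Type} [CommRing R] (m : ℕ) (a : R) (φ : Finset V → Finset V → R) :
    a • cochainForm K m φ = cochainForm K m fun F H => a * φ F H := by
  refine LinearMap.ext fun g => ?_
  change a * ∑ F : Finset V, ∑ H : Finset V, _ = ∑ F : Finset V, ∑ H : Finset V, _
  simp only [Finset.mul_sum]
  exact Finset.sum_congr rfl fun F _ => Finset.sum_congr rfl fun H _ => by ring

lemma cochainForm_comp_resD_eq_zero {R : Type} [CommRing R] {x : V → R} {m : ℕ}
    {φ : Finset V → Finset V → R} (hφ : ∀ F H, Disjoint F H → F ∉ K → φ F H = 0)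
    (h : ∀ F H, Disjoint F H → codiff x φ F H = 0) :
    cochainForm K m φ ∘ₗ resD x K m = 0 := by
  rw [cochainForm_comp_resD hφ, ← cochainForm_zero]
  exact cochainForm_eq_iff.2 fun F _ H hd _ => h F H hd

lemma exists_eq_cochainForm {R : Type} [CommRing R] {m : ℕ} (f : (ResIndex K m → R) →ₗ[R] R) :
    ∃ φ : Finset V → Finset V → R, f = cochainForm K m φ ∧
      ∀ F H, ¬ (F ∈ K ∧ Disjoint F H ∧ H.card = m) → φ F H = 0 :=
  ⟨_, eq_cochainForm f, fun _ _ h => extend_of_notMem _ h⟩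

lemma codiff_eq_zero_of_comp_resD {R : Type} [CommRing R] {x : V → R} (hK : IsComplex K) {m : ℕ}
    {φ : Finset V → Finset V → R} (hφ : ∀ F H, ¬ (F ∈ K ∧ Disjoint F H ∧ H.card = m) → φ F H = 0)
    (h : cochainForm K m φ ∘ₗ resD x K m = 0) {F H : Finset V} (hd : Disjoint F H) :
    codiff x φ F H = 0 := by
  have hφ1 : ∀ F H, Disjoint F H → F ∉ K → φ F H = 0 := fun F H _ hF => hφ F H fun h => hF h.1
  rw [cochainForm_comp_resD hφ1, ← cochainForm_zero, cochainForm_eq_iff] at h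
  by_cases hF : F ∈ K
  · by_cases hH : H.card = m + 1
    · exact h F hF H hd hH
    · exact codiff_eq_zero_of_card_ne (fun F H _ hH => hφ F H fun h => hH h.2.2) hd hH
  · exact codiff_eq_zero_of_notMem hK hφ1 hd hF

/-- The annihilator of `Ext` of a Stanley–Reisner ring in terms of cochains. -/
theorem mem_annihilator_extM_srRing_iff (hK : IsComplex K) (a : MvPolynomial V k) (m : ℕ) :
    a ∈ Module.annihilator (MvPolynomial V k)
        (extM (srRing k K) (ModuleCat.of _ (MvPolynomial V k)) m) ↔
      ∀ φ : Finset V → Finset V → MvPolynomial V k,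
        (∀ F H, Disjoint F H → F ∉ K → φ F H = 0) →
        (∀ F H, Disjoint F H → H.card ≠ m → φ F H = 0) →
        (∀ F H, Disjoint F H → codiff X φ F H = 0) →
        ∃ ψ : Finset V → Finset V → MvPolynomial V k, (∀ F H, F ∉ K → ψ F H = 0) ∧
          (∀ F H, H.card + 1 ≠ m → ψ F H = 0) ∧
          ∀ F H, Disjoint F H → a * φ F H = codiff X ψ F H := by
  cases m with
  | zero =>
    refine (mem_annihilator_extM_zero_iff (P := fun i => ResIndex K i → MvPolynomial V k)
      (resD X K) (resAug k K)
      (resD_exact regularSubsets_X hK) (resD_resAug_exact hK) (resAug_surjective hK) a).trans ?_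
    constructor
    · intro h φ h1 h2 h3
      have h4 := h _ (cochainForm_comp_resD_eq_zero h1 h3)
      rw [smul_cochainForm, ← cochainForm_zero, cochainForm_eq_iff] at h4
      refine ⟨fun _ _ => 0, by simp, by simp, fun F H hd => ?_⟩
      have : codiff X (fun _ _ => (0 : MvPolynomial V k)) F H = 0 := by simp [codiff]
      rw [this]
      by_cases hF : F ∈ K
      · by_cases hH : H.card = 0
        · exact h4 F hF H hd hH
        · rw [h2 F H hd hH, mul_zero]
      · rw [h1 F H hd hF, mul_zero]
    · intro h f hf
      obtain ⟨φ, rfl, hφ⟩ := exists_eq_cochainForm f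
      obtain ⟨ψ, -, h2, h3⟩ := h φ (fun F H _ hF => hφ F H fun h => hF h.1)
        (fun F H _ hH => hφ F H fun h => hH h.2.2)
        (fun F H hd => codiff_eq_zero_of_comp_resD hK hφ hf hd)
      rw [smul_cochainForm, ← cochainForm_zero, cochainForm_eq_iff]
      intro F hF H hd hH
      rw [h3 F H hd]
      exact Finset.sum_eq_zero fun v hv => by
        rw [Finset.card_eq_zero.1 hH] at hv; simp at hv
  | succ m =>
    refine (mem_annihilator_extM_succ_iff (P := fun i => ResIndex K i → MvPolynomial V k)
      (resD X K) (resAug k K)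
      (resD_exact regularSubsets_X hK) (resD_resAug_exact hK) (resAug_surjective hK) a m).trans ?_
    constructor
    · intro h φ h1 h2 h3
      obtain ⟨g, h4⟩ := h _ (cochainForm_comp_resD_eq_zero h1 h3)
      obtain ⟨ψ, rfl, hψ⟩ := exists_eq_cochainForm g
      have hψ1 : ∀ F H, Disjoint F H → F ∉ K → ψ F H = 0 :=
        fun F H _ hF => hψ F H fun h => hF h.1
      rw [cochainForm_comp_resD hψ1, smul_cochainForm, cochainForm_eq_iff] at h4
      refine ⟨ψ, fun F H hF => hψ F H fun h => hF h.1,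
        fun F H hH => hψ F H fun h => hH (by omega), fun F H hd => ?_⟩
      by_cases hF : F ∈ K
      · by_cases hH : H.card = m + 1
        · exact (h4 F hF H hd hH).symm
        · rw [h2 F H hd hH, mul_zero,
            codiff_eq_zero_of_card_ne (fun F H _ hH => hψ F H fun h => hH h.2.2) hd hH]
      · rw [h1 F H hd hF, mul_zero, codiff_eq_zero_of_notMem hK hψ1 hd hF]
    · intro h f hf
      obtain ⟨φ, rfl, hφ⟩ := exists_eq_cochainForm f
      obtain ⟨ψ, h1, h2, h3⟩ := h φ (fun F H _ hF => hφ F H fun h => hF h.1)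
        (fun F H _ hH => hφ F H fun h => hH h.2.2)
        (fun F H hd => codiff_eq_zero_of_comp_resD hK hφ hf hd)
      refine ⟨cochainForm K m ψ, ?_⟩
      rw [cochainForm_comp_resD fun F H _ hF => h1 F H hF, smul_cochainForm, cochainForm_eq_iff]
      exact fun F _ H hd _ => (h3 F H hd).symm

end StanleyReisner

end SerrePaper

namespace SerrePaper

section RelativeCochains

variable {V : Type} {k : Type} [Field k]

lemma coeff_eq_zero_of_mem_span {H : Finset V} {p : MvPolynomial V k} {e : V →₀ ℕ}
    (hp : p ∈ Ideal.span ((X : V → MvPolynomial V k) '' (H : Set V)))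
    (he : ∀ v ∈ H, e v = 0) : coeff e p = 0 := by
  by_contra h
  exact notMem_span_X_of_eval (mem_support_iff.2 h) he hp

variable [LinearOrder V]

lemma coeff_sgn_mul (v : V) (H : Finset V) (p : MvPolynomial V k) (e : V →₀ ℕ) :
    coeff e (sgn (MvPolynomial V k) v H * p) = sgn k v H * coeff e p := by
  have : sgn (MvPolynomial V k) v H = C (sgn k v H) := by simp [sgn]
  rw [this, coeff_C_mul]

lemma coeff_koszul_one (b : Finset V → MvPolynomial V k) (H : Finset V) (e : V →₀ ℕ) :
    coeff e (koszul 1 b H) = koszul 1 (fun G => coeff e (b G)) H := by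
  rw [koszul, koszul, coeff_sum]
  exact Finset.sum_congr rfl fun v _ => by rw [coeff_sgn_mul]; simp

variable [Fintype V]

/-- Exactness in degree `m` of the complex of functions on the subsets of `W` whose complement
is a face of `K`. -/
def CochainExact (k : Type) [Field k] (K : Set (Finset V)) (W : Finset V) (m : ℕ) : Prop :=
  ∀ c : Finset V → k, (∀ H, Hᶜ ∉ K → c H = 0) → (∀ H, H.card ≠ m → c H = 0) →
    (∀ H ⊆ W, koszul 1 c H = 0) →
    ∃ b : Finset V → k, (∀ H, Hᶜ ∉ K → b H = 0) ∧ (∀ H, H.card + 1 ≠ m → b H = 0) ∧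
      ∀ H ⊆ W, c H = koszul 1 b H

/-- The cochain concentrated on the pairs `(Hᶜ, H)`. -/
noncomputable def diagCochain {R : Type} [CommRing R] (z : Finset V → R) (F H : Finset V) : R :=
  if F = Hᶜ then z H else 0

lemma diagCochain_compl {R : Type} [CommRing R] (z : Finset V → R) (H : Finset V) :
    diagCochain z Hᶜ H = z H := if_pos rfl

lemma insert_compl_eq_compl_erase {H : Finset V} (v : V) :
    insert v Hᶜ = (H.erase v)ᶜ := by
  rw [Finset.compl_erase]

lemma codiff_compl {R : Type} [CommRing R] (x : V → R) (φ : Finset V → Finset V → R)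
    (H : Finset V) :
    codiff x φ Hᶜ H = koszul x (φ Hᶜ) H + koszul 1 (fun G => φ Gᶜ G) H := by
  rw [codiff, koszul, koszul, ← Finset.sum_add_distrib]
  refine Finset.sum_congr rfl fun v _ => ?_
  rw [insert_compl_eq_compl_erase, Pi.one_apply]
  ring

lemma codiff_diagCochain_compl {R : Type} [CommRing R] (x : V → R) (z : Finset V → R)
    (H : Finset V) : codiff x (diagCochain z) Hᶜ H = koszul 1 z H := by
  rw [codiff_compl]
  have h1 : koszul x (diagCochain z Hᶜ) H = 0 := by
    refine Finset.sum_eq_zero fun v hv => ?_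
    rw [diagCochain, if_neg fun h => ?_]
    · simp
    · have := compl_injective h
      rw [this] at hv; simp at hv
  rw [h1, zero_add]
  exact koszul_congr fun v _ => diagCochain_compl z _

variable {K : Set (Finset V)}

/-- Exactness in each multidegree gives exactness modulo the variable ideals. -/
lemma exists_sub_koszul_mem_span {m : ℕ} (z : Finset V → MvPolynomial V k)
    (hz1 : ∀ H, Hᶜ ∉ K → z H = 0) (hz2 : ∀ H, H.card ≠ m → z H = 0)
    (hz3 : ∀ H : Finset V, koszul 1 z H ∈ Ideal.span ((X : V → MvPolynomial V k) '' (H : Set V)))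
    (hz4 : ∀ e : V →₀ ℕ, (∃ H, coeff e (z H) ≠ 0) → CochainExact k K e.supportᶜ m) :
    ∃ b : Finset V → MvPolynomial V k, (∀ H, Hᶜ ∉ K → b H = 0) ∧
      (∀ H, H.card + 1 ≠ m → b H = 0) ∧
      ∀ H : Finset V, z H - koszul 1 b H ∈ Ideal.span ((X : V → MvPolynomial V k) '' (H : Set V)) := by
  have key : ∀ e : V →₀ ℕ, ∃ b : Finset V → k, (∀ H, Hᶜ ∉ K → b H = 0) ∧
      (∀ H, H.card + 1 ≠ m → b H = 0) ∧
      (∀ H ⊆ e.supportᶜ, coeff e (z H) = koszul 1 b H) ∧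
      ((∀ H, coeff e (z H) = 0) → ∀ H, b H = 0) := by
    intro e
    by_cases he : ∃ H, coeff e (z H) ≠ 0
    · obtain ⟨b, h1, h2, h3⟩ := hz4 e he (fun H => coeff e (z H))
        (fun H hH => by rw [hz1 H hH, coeff_zero]) (fun H hH => by rw [hz2 H hH, coeff_zero])
        (fun H hH => by
          rw [← coeff_koszul_one]
          refine coeff_eq_zero_of_mem_span (hz3 H) fun v hv => ?_
          simpa using hH hv)
      exact ⟨b, h1, h2, h3, fun h => absurd he (by simpa using h)⟩
    · push Not at he
      exact ⟨0, by simp, by simp, fun H _ => by rw [he H]; simp [koszul], by simp⟩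
  choose b hb1 hb2 hb3 hb4 using key
  let E : Finset (V →₀ ℕ) := Finset.univ.biUnion fun H => (z H).support
  have hE : ∀ e H, coeff e (∑ e ∈ E, monomial e (b e H)) = b e H := by
    intro e H
    rw [coeff_sum]
    simp only [coeff_monomial]
    rw [Finset.sum_ite_eq']
    split_ifs with h
    · rfl
    · refine (hb4 e (fun G => ?_) H).symm
      by_contra hG
      exact h (Finset.mem_biUnion.2 ⟨G, Finset.mem_univ _, mem_support_iff.2 hG⟩)
  refine ⟨fun H => ∑ e ∈ E, monomial e (b e H), fun H hH => ?_, fun H hH => ?_, fun H => ?_⟩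
  · exact Finset.sum_eq_zero fun e _ => by rw [hb1 e H hH, monomial_zero]
  · exact Finset.sum_eq_zero fun e _ => by rw [hb2 e H hH, monomial_zero]
  · rw [mem_ideal_span_X_image]
    intro e he
    by_contra! hcon
    rw [mem_support_iff, coeff_sub, coeff_koszul_one] at he
    simp only [hE] at he
    refine he (sub_eq_zero.2 (hb3 e H fun v hv => ?_))
    simpa using hcon v hv

lemma mem_annihilator_extM_srRing_of_exact (hK : IsComplex K) (m : ℕ) (A : Finset V)
    (h : ∀ B, A ⊆ B → CochainExact k K Bᶜ m) :
    ∏ v ∈ A, X v ∈ Module.annihilator (MvPolynomial V k)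
      (extM (srRing k K) (ModuleCat.of _ (MvPolynomial V k)) m) := by
  rw [mem_annihilator_extM_srRing_iff hK]
  intro φ h1 h2 h3
  set a : MvPolynomial V k := ∏ v ∈ A, X v with ha
  have hd : ∀ H : Finset V, Disjoint Hᶜ H := fun H => disjoint_compl_left
  obtain ⟨b, hb1, hb2, hb3⟩ := exists_sub_koszul_mem_span (K := K) (m := m)
    (fun H => a * φ Hᶜ H)
    (fun H hH => by rw [h1 _ _ (hd H) hH, mul_zero])
    (fun H hH => by rw [h2 _ _ (hd H) hH, mul_zero])
    (fun H => by
      rw [koszul_smul]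
      refine Ideal.mul_mem_left _ _ ?_
      have := h3 Hᶜ H (hd H)
      rw [codiff_compl] at this
      rw [eq_neg_of_add_eq_zero_right this]
      exact neg_mem (koszul_mem_span _ _ _))
    (fun e ⟨H, he⟩ => by
      refine h _ fun v hv => ?_
      by_contra hve
      refine he (coeff_eq_zero_of_mem_span (H := {v}) (Ideal.mul_mem_right _ _
        (Ideal.mem_of_dvd _ (Finset.dvd_prod_of_mem _ hv) (Ideal.subset_span (by simp)))) ?_)
      simpa using hve)
  have hφ1 : ∀ F H, F ∉ K → diagCochain b F H = 0 := by
    intro F H hF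
    unfold diagCochain
    split_ifs with h
    · exact hb1 H (h ▸ hF)
    · rfl
  have hφ2 : ∀ F H, H.card + 1 ≠ m → diagCochain b F H = 0 := by
    intro F H hH
    simp [diagCochain, hb2 H hH]
  have hφ3 : ∀ F H, Disjoint F H → H.card ≠ m → codiff X (diagCochain b) F H = 0 := by
    intro F H hFH hH
    rw [codiff_congr (ψ := fun _ _ => 0) X hFH fun F' H' hd' _ hc => hφ2 F' H' (by omega)]
    simp [codiff]
  obtain ⟨ψ, hψ1, hψ2, -, hψ3⟩ := (regularSubsets_X (k := k)).exists_codiff_eq m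
    (Set.toFinite K).toFinset (by simpa using hK.2)
    (fun F H => a * φ F H - codiff X (diagCochain b) F H)
    (fun F H hFH hF => by
      rw [Set.Finite.mem_toFinset] at hF
      rw [h1 F H hFH hF, codiff_eq_zero_of_notMem hK (fun F H _ => hφ1 F H) hFH hF, mul_zero, sub_zero])
    (fun F H hFH hH => by
      rw [h2 F H hFH hH, hφ3 F H hFH hH, mul_zero, sub_zero])
    (fun F H hFH => by
      rw [codiff_sub, codiff_smul, codiff_codiff, h3 F H hFH, mul_zero, sub_zero])
    (fun F _ => by
      have := hb3 Fᶜ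
      rw [← codiff_diagCochain_compl X, compl_compl] at this
      exact this)
  refine ⟨fun F H => diagCochain b F H + ψ F H, fun F H hF => ?_, fun F H hH => ?_,
    fun F H hFH => ?_⟩
  · dsimp only
    rw [hφ1 F H hF, hψ1 F H (by simpa using hF), add_zero]
  · dsimp only
    rw [hφ2 F H hH, hψ2 F H hH, add_zero]
  · rw [codiff_add, ← hψ3 F H hFH, add_sub_cancel]

lemma annihilator_extM_srRing_le_of_not_exact (hK : IsComplex K) (m : ℕ) (A : Finset V)
    (h : ¬ CochainExact k K Aᶜ m) :
    Module.annihilator (MvPolynomial V k)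
      (extM (srRing k K) (ModuleCat.of _ (MvPolynomial V k)) m) ≤
    Ideal.span ((X : V → MvPolynomial V k) '' (Aᶜ : Finset V)) := by
  intro f hf
  rw [mem_annihilator_extM_srRing_iff hK] at hf
  by_contra hfA
  refine h fun c hc1 hc2 hc3 => ?_
  set a : MvPolynomial V k := ∏ v ∈ A, X v with ha
  set z : Finset V → MvPolynomial V k := fun H => a * C (c H) with hz
  have hkz : ∀ H, koszul 1 z H = a * C (koszul 1 c H) := by
    intro H
    rw [hz, koszul_smul]
    simp [koszul, sgn]
  have hz1 : ∀ F H, F ∉ K → diagCochain z F H = 0 := by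
    intro F H hF
    unfold diagCochain
    split_ifs with h
    · simp [hz, hc1 H (h ▸ hF)]
    · rfl
  have hz2 : ∀ F H, H.card ≠ m → diagCochain z F H = 0 := by
    intro F H hH
    simp [diagCochain, hz, hc2 H hH]
  obtain ⟨ψ, hψ1, hψ2, hψ0, hψ3⟩ := (regularSubsets_X (k := k)).exists_codiff_eq (m + 1)
    (Set.toFinite K).toFinset (by simpa using hK.2) (codiff X (diagCochain z))
    (fun F H hFH hF => codiff_eq_zero_of_notMem hK (fun F H _ => hz1 F H) hFH (by simpa using hF))
    (fun F H hFH hH => codiff_eq_zero_of_card_ne (fun F H _ => hz2 F H) hFH hH)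
    (fun F H _ => codiff_codiff _ _ _ _)
    (fun F _ => by
      have := codiff_diagCochain_compl X z Fᶜ
      rw [compl_compl] at this
      rw [this, hkz]
      by_cases hFA : Fᶜ ⊆ Aᶜ
      · rw [hc3 _ hFA]; simp
      · obtain ⟨v, hvF, hvA⟩ := Finset.not_subset.1 hFA
        exact Ideal.mul_mem_right _ _ (Ideal.mem_of_dvd _
          (Finset.dvd_prod_of_mem _ (by simpa using hvA)) (Ideal.subset_span ⟨v, hvF, rfl⟩)))
  obtain ⟨w, hw1, hw2, hw3⟩ := hf (fun F H => diagCochain z F H - ψ F H)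
    (fun F H _ hF => by rw [hz1 F H hF, hψ1 F H (by simpa using hF), sub_zero])
    (fun F H _ hH => by rw [hz2 F H hH, hψ2 F H (by simpa using hH), sub_zero])
    (fun F H hFH => by rw [codiff_sub, ← hψ3 F H hFH, sub_self])
  rw [mem_ideal_span_X_image] at hfA
  push Not at hfA
  obtain ⟨u, hu, huA⟩ := hfA
  set e : V →₀ ℕ := u + ∑ v ∈ A, Finsupp.single v 1 with he
  have hae : a = monomial (∑ v ∈ A, Finsupp.single v 1) 1 := by
    rw [ha, monomial_sum_one]; rfl
  have hcoef : ∀ H ⊆ Aᶜ, coeff u f * c H = koszul 1 (fun G => coeff e (w Gᶜ G)) H := by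
    intro H hH
    have h1 := hw3 Hᶜ H disjoint_compl_left
    rw [codiff_compl, diagCochain_compl] at h1
    have h2 : ψ Hᶜ H = 0 := by simpa using hψ0 Hᶜ
    have h3 := congrArg (coeff e) h1
    rw [coeff_add, coeff_koszul_one, coeff_eq_zero_of_mem_span (koszul_mem_span _ _ _), zero_add,
      h2, sub_zero] at h3
    · rw [← h3, hz, hae]
      simp only
      rw [mul_comm _ (C (c H)), C_mul_monomial, mul_one, he, coeff_mul_monomial]
    · intro v hv
      have hvA : v ∉ A := by simpa using hH hv
      rw [he, Finsupp.add_apply, huA v (hH hv), Finsupp.finsetSum_apply]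
      simp only [zero_add]
      refine Finset.sum_eq_zero fun i hi => ?_
      rw [Finsupp.single_apply, if_neg]
      rintro rfl
      exact hvA hi
  refine ⟨fun G => (coeff u f)⁻¹ * coeff e (w Gᶜ G), fun H hH => ?_, fun H hH => ?_,
    fun H hH => ?_⟩
  · dsimp only
    rw [hw1 _ _ hH, coeff_zero, mul_zero]
  · dsimp only
    rw [hw2 _ _ hH, coeff_zero, mul_zero]
  · rw [koszul_smul, ← hcoef H hH, inv_mul_cancel_left₀ (mem_support_iff.1 hu)]

end RelativeCochains

end SerrePaper

namespace SerrePaper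

section Dimension

variable {V : Type} {k : Type} [Field k]

open Classical in
/-- The quotient map setting the variables outside `A` to zero. -/
noncomputable def restrictVars (k : Type) [Field k] (A : Finset V) :
    MvPolynomial V k →ₐ[k] MvPolynomial A k :=
  aeval fun v => if h : v ∈ A then X ⟨v, h⟩ else 0

lemma restrictVars_surjective (A : Finset V) : Function.Surjective (restrictVars k A) := by
  intro p
  refine ⟨rename Subtype.val p, ?_⟩
  have : (restrictVars k A).comp (rename Subtype.val) = AlgHom.id k _ := by
    refine algHom_ext fun v => ?_
    simp [restrictVars]
  exact congrArg (fun f => f p) this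

lemma ringKrullDim_mvPolynomial_finset (A : Finset V) :
    ringKrullDim (MvPolynomial A k) = A.card := by
  simp

lemma card_le_ringKrullDim_quotient [Fintype V] [DecidableEq V] {I : Ideal (MvPolynomial V k)}
    {A : Finset V}
    (hI : I ≤ Ideal.span ((X : V → MvPolynomial V k) '' (Aᶜ : Finset V))) :
    (A.card : WithBot ℕ∞) ≤ ringKrullDim (MvPolynomial V k ⧸ I) := by
  rw [← ringKrullDim_mvPolynomial_finset (k := k)]
  have hker : I ≤ RingHom.ker (restrictVars k A) := by
    refine hI.trans ?_
    rw [Ideal.span_le]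
    rintro _ ⟨v, hv, rfl⟩
    have : v ∉ A := by simpa using hv
    simp [restrictVars, this]
  refine ringKrullDim_le_of_surjective (Ideal.Quotient.lift I (restrictVars k A).toRingHom hker)
    (Ideal.Quotient.lift_surjective_of_surjective _ _ (restrictVars_surjective A))

lemma ringKrullDim_le_card_of_surjective {T : Type} [CommSemiring T] [Algebra k T]
    (g : MvPolynomial V k →ₐ[k] T) (hg : Function.Surjective g) (A : Finset V)
    (hA : ∀ v ∉ A, g (X v) = 0) : ringKrullDim T ≤ A.card := by
  rw [← ringKrullDim_mvPolynomial_finset (k := k)]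
  have h : (g.comp (rename Subtype.val)).comp (restrictVars k A) = g := by
    refine algHom_ext fun v => ?_
    by_cases hv : v ∈ A
    · simp [restrictVars, hv]
    · simp [restrictVars, hv, hA v hv]
  refine ringKrullDim_le_of_surjective (g.comp (rename Subtype.val)).toRingHom fun y => ?_
  obtain ⟨p, rfl⟩ := hg y
  exact ⟨restrictVars k A p, congrArg (fun f => f p) h⟩

lemma exists_notMem_of_le_ringKrullDim_quotient [Fintype V] {I : Ideal (MvPolynomial V k)} {t : ℕ}
    (ht : (t : WithBot ℕ∞) ≤ ringKrullDim (MvPolynomial V k ⧸ I)) :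
    ∃ A : Finset V, t ≤ A.card ∧ ∏ v ∈ A, X v ∉ I := by
  classical
  obtain ⟨l, rfl⟩ := Order.le_krullDim_iff.1 ht
  set q := l.head with hq
  let A : Finset V := {v | Ideal.Quotient.mk I (X v) ∉ q.asIdeal}
  refine ⟨A, ?_, fun h => ?_⟩
  · let g : MvPolynomial V k →ₐ[k] (MvPolynomial V k ⧸ I) ⧸ q.asIdeal :=
      (Ideal.Quotient.mkₐ k q.asIdeal).comp (Ideal.Quotient.mkₐ k I)
    have h1 : ringKrullDim ((MvPolynomial V k ⧸ I) ⧸ q.asIdeal) ≤ A.card :=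
      ringKrullDim_le_card_of_surjective g
        ((Ideal.Quotient.mkₐ_surjective k _).comp (Ideal.Quotient.mkₐ_surjective k _)) A
        (fun v hv => by
          have : Ideal.Quotient.mk I (X v) ∈ q.asIdeal := by simpa [A] using hv
          exact Ideal.Quotient.eq_zero_iff_mem.2 this)
    rw [ringKrullDim_quotient] at h1
    let l' : LTSeries (PrimeSpectrum.zeroLocus (q.asIdeal : Set (MvPolynomial V k ⧸ I))) :=
      LTSeries.mk l.length (fun i => ⟨l i, LTSeries.head_le l i⟩) fun i j hij => l.strictMono hij
    exact_mod_cast (Order.LTSeries.length_le_krullDim l').trans h1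
  · have h1 : ∏ v ∈ A, Ideal.Quotient.mk I (X v) ∈ q.asIdeal := by
      rw [← map_prod, Ideal.Quotient.eq_zero_iff_mem.2 h]
      exact Ideal.zero_mem _
    obtain ⟨v, hv, hv'⟩ := (q.isPrime.prod_mem_iff).1 h1
    simp [A] at hv
    exact hv hv'

variable [LinearOrder V] [Fintype V] {K : Set (Finset V)}

theorem le_modDim_extM_iff (hK : IsComplex K) (m t : ℕ) :
    (t : WithBot ℕ∞) ≤
        modDim (extM (srRing k K) (ModuleCat.of _ (MvPolynomial V k)) m) ↔
      ∃ A : Finset V, t ≤ A.card ∧ ¬ CochainExact k K Aᶜ m := by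
  constructor
  · intro h
    obtain ⟨A, hA, hA'⟩ := exists_notMem_of_le_ringKrullDim_quotient h
    by_contra! hcon
    exact hA' (mem_annihilator_extM_srRing_of_exact hK m A fun B hB =>
      hcon B (hA.trans (Finset.card_le_card hB)))
  · rintro ⟨A, hA, hA'⟩
    exact le_trans (by exact_mod_cast hA)
      (card_le_ringKrullDim_quotient (annihilator_extM_srRing_le_of_not_exact hK m A hA'))

theorem hasDimCard_of_modDim_eq (hK : IsComplex K) {d : ℕ}
    (hd : modDim (srRing k K) = (d : WithBot ℕ∞)) : HasDimCard K d := by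
  have hann : modDim (srRing k K) = ringKrullDim (MvPolynomial V k ⧸ srIdeal k K) := by
    have : Module.annihilator (MvPolynomial V k) (srRing k K) = srIdeal k K :=
      Ideal.annihilator_quotient
    rw [modDim, this]
  rw [hann] at hd
  have h1 : ∀ F ∈ K, F.card ≤ d := fun F hF => by
    have := card_le_ringKrullDim_quotient (srIdeal_le_span_X (k := k) hK hF)
    rw [hd] at this
    exact_mod_cast this
  refine ⟨?_, h1⟩
  obtain ⟨A, hA, hA'⟩ := exists_notMem_of_le_ringKrullDim_quotient hd.ge
  have hAK : A ∈ K := by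
    by_contra h
    exact hA' (Ideal.subset_span ⟨A, h, rfl⟩)
  exact ⟨A, hAK, le_antisymm (h1 A hAK) hA⟩

end Dimension

end SerrePaper

namespace SerrePaper

section DualComplexes

lemma exact_iff_dual_exact {k A B C : Type} [Field k] [AddCommGroup A] [Module k A]
    [AddCommGroup B] [Module k B] [AddCommGroup C] [Module k C] (f : A →ₗ[k] B) (g : B →ₗ[k] C) :
    (∀ z, g z = 0 → ∃ b, f b = z) ↔
      ∀ φ : B →ₗ[k] k, φ ∘ₗ f = 0 → ∃ ψ : C →ₗ[k] k, ψ ∘ₗ g = φ := by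
  have h1 : (∀ z, g z = 0 → ∃ b, f b = z) ↔ LinearMap.ker g ≤ LinearMap.range f := Iff.rfl
  have h2 : (∀ φ : B →ₗ[k] k, φ ∘ₗ f = 0 → ∃ ψ : C →ₗ[k] k, ψ ∘ₗ g = φ) ↔
      LinearMap.ker f.dualMap ≤ LinearMap.range g.dualMap := Iff.rfl
  rw [h1, h2, LinearMap.range_dualMap_eq_dualAnnihilator_ker,
    LinearMap.ker_dualMap_eq_dualAnnihilator_range, Subspace.dualAnnihilator_le_dualAnnihilator_iff]

variable {V : Type} {k : Type} [Field k]

/-- The linear form on chains given by a function on finite sets. -/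
noncomputable def chainForm (L : Set (Finset V)) (c : ℕ) (w : Finset V → k) :
    chainGroup k L c →ₗ[k] k :=
  Finsupp.linearCombination k fun F => w F.1

lemma chainForm_single {L : Set (Finset V)} {c : ℕ} (w : Finset V → k)
    (F : {F : Finset V // F ∈ L ∧ F.card = c}) (a : k) :
    chainForm L c w (Finsupp.single F a) = a * w F.1 := by
  simp [chainForm]

lemma chainForm_eq_iff {L : Set (Finset V)} {c : ℕ} {w y : Finset V → k} :
    chainForm L c w = chainForm L c y ↔ ∀ F ∈ L, F.card = c → w F = y F := by
  constructor
  · intro h F hF hc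
    simpa [chainForm_single] using
      congrArg (fun f => f (Finsupp.single ⟨F, hF, hc⟩ (1 : k))) h
  · intro h
    refine Finsupp.lhom_ext fun F a => ?_
    rw [chainForm_single, chainForm_single, h F.1 F.2.1 F.2.2]

lemma chainForm_eq_zero_iff {L : Set (Finset V)} {c : ℕ} {w : Finset V → k} :
    chainForm L c w = 0 ↔ ∀ F ∈ L, F.card = c → w F = 0 := by
  have : chainForm L c (fun _ => (0 : k)) = 0 := by
    refine Finsupp.lhom_ext fun F a => ?_
    simp [chainForm_single]
  rw [← this, chainForm_eq_iff]

lemma exists_eq_chainForm {L : Set (Finset V)} {c : ℕ} (f : chainGroup k L c →ₗ[k] k) :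
    ∃ w : Finset V → k, f = chainForm L c w := by
  classical
  refine ⟨fun F => if h : F ∈ L ∧ F.card = c then f (Finsupp.single ⟨F, h⟩ 1) else 0,
    Finsupp.lhom_ext fun F a => ?_⟩
  rw [chainForm_single, dif_pos F.2, ← smul_eq_mul, ← map_smul, Finsupp.smul_single, smul_eq_mul,
    mul_one]

lemma regularSubsets_one : RegularSubsets (1 : V → k) := by
  intro U v _ a ha
  simpa using ha

variable [LinearOrder V]

lemma chainForm_comp_boundary {L : Set (Finset V)} (hL : ∀ F ∈ L, ∀ G ⊆ F, G ∈ L) (c : ℕ)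
    (w : Finset V → k) :
    chainForm L c w ∘ₗ boundary k L c = chainForm L (c + 1) (koszul 1 w) := by
  refine Finsupp.lhom_ext fun F a => ?_
  rw [LinearMap.comp_apply, chainForm_single, boundary, Finsupp.lsum_single,
    LinearMap.toSpanSingleton_apply, map_smul, smul_eq_mul, boundaryAt, map_sum, koszul,
    ← Finset.sum_attach F.1]
  congr 1
  refine Finset.sum_congr rfl fun x _ => ?_
  have hx : F.1.erase x.1 ∈ L := hL _ F.2.1 _ (Finset.erase_subset _ _)
  simp only [hx, dif_pos, chainForm_single]
  simp [sgn]

/-- Exactness of the simplicial cochain complex of `L` at the sets of cardinality `c`. -/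
def CohomologyVanishes (k : Type) [Field k] (L : Set (Finset V)) (c : ℕ) : Prop :=
  ∀ w : Finset V → k, (∀ H ∈ L, H.card = c + 1 → koszul 1 w H = 0) →
    ∃ y : Finset V → k, ∀ H ∈ L, H.card = c → w H = koszul 1 y H

lemma reducedHomologyVanishes_iff_cohomologyVanishes {L : Set (Finset V)}
    (hL : ∀ F ∈ L, ∀ G ⊆ F, G ∈ L) (c : ℕ) :
    reducedHomologyVanishes k L ((c : ℤ) - 1) ↔ CohomologyVanishes k L c := by
  cases c with
  | zero =>
    have h1 : reducedHomologyVanishes k L (((0 : ℕ) : ℤ) - 1) ↔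
        ∀ z : chainGroup k L 0, (0 : chainGroup k L 0 →ₗ[k] k) z = 0 →
          ∃ b, boundary k L 0 b = z := by
      simp [reducedHomologyVanishes]
    rw [h1, exact_iff_dual_exact]
    constructor
    · intro h w hw
      obtain ⟨ψ, hψ⟩ := h (chainForm L 0 w) (by
        rw [chainForm_comp_boundary hL, chainForm_eq_zero_iff]; exact hw)
      rw [LinearMap.comp_zero, eq_comm, chainForm_eq_zero_iff] at hψ
      refine ⟨0, fun H hH hc => ?_⟩
      rw [hψ H hH hc]
      simp [koszul]
    · intro h φ hφ
      obtain ⟨w, rfl⟩ := exists_eq_chainForm φ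
      rw [chainForm_comp_boundary hL, chainForm_eq_zero_iff] at hφ
      obtain ⟨y, hy⟩ := h w hφ
      refine ⟨0, ?_⟩
      rw [LinearMap.zero_comp, eq_comm, chainForm_eq_zero_iff]
      intro F hF hc
      rw [hy F hF hc, Finset.card_eq_zero.1 hc]
      simp [koszul]
  | succ c =>
    have h1 : reducedHomologyVanishes k L (((c + 1 : ℕ) : ℤ) - 1) ↔
        ∀ z : chainGroup k L (c + 1), boundary k L c z = 0 →
          ∃ b, boundary k L (c + 1) b = z := by
      have : ((c + 1 : ℕ) : ℤ) - 1 = c := by push_cast; ring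
      rw [this, reducedHomologyVanishes, if_neg (by omega), if_neg (by omega)]
      rfl
    rw [h1, exact_iff_dual_exact]
    constructor
    · intro h w hw
      obtain ⟨ψ, hψ⟩ := h (chainForm L (c + 1) w) (by
        rw [chainForm_comp_boundary hL, chainForm_eq_zero_iff]; exact hw)
      obtain ⟨y, rfl⟩ := exists_eq_chainForm ψ
      rw [chainForm_comp_boundary hL, eq_comm, chainForm_eq_iff] at hψ
      exact ⟨y, hψ⟩
    · intro h φ hφ
      obtain ⟨w, rfl⟩ := exists_eq_chainForm φ
      rw [chainForm_comp_boundary hL, chainForm_eq_zero_iff] at hφ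
      obtain ⟨y, hy⟩ := h w hφ
      refine ⟨chainForm L c y, ?_⟩
      rw [chainForm_comp_boundary hL, eq_comm, chainForm_eq_iff]
      exact hy

lemma exists_koszul_one_eq {W : Finset V} (hW : W.Nonempty) (m : ℕ) (c : Finset V → k)
    (hm : ∀ G ⊆ W, G.card ≠ m → c G = 0) (hc : ∀ G ⊆ W, koszul 1 c G = 0) :
    ∃ b : Finset V → k, (∀ G, G.card + 1 ≠ m → b G = 0) ∧ ∀ G ⊆ W, c G = koszul 1 b G := by
  obtain ⟨b, h1, -, h2⟩ := regularSubsets_one.exists_koszul_eq W m c hm hc (by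
    obtain ⟨v, hv⟩ := hW
    have h1 : Ideal.span ((1 : V → k) '' W) = ⊤ :=
      (Ideal.eq_top_iff_one _).2 (Ideal.subset_span ⟨v, hv, rfl⟩)
    rw [h1]
    trivial)
  exact ⟨b, h1, h2⟩

variable [Fintype V] {K : Set (Finset V)}

lemma cohomologyVanishes_dual_iff (hK : IsComplex K) {W : Finset V} (hW : W.Nonempty) (c : ℕ) :
    CohomologyVanishes k (inducedSub (dualComplex K) W) c ↔ CochainExact k K W (c + 1) := by
  classical
  constructor
  · intro h z hz1 hz2 hz3
    obtain ⟨y, hy1, hy2⟩ := exists_koszul_one_eq hW (c + 1) z (fun G _ => hz2 G) hz3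
    obtain ⟨u, hu⟩ := h y fun H hH _ => by rw [← hy2 H hH.2, hz1 H hH.1]
    refine ⟨fun H => if Hᶜ ∈ K ∧ H.card = c then y H - koszul 1 u H else 0,
      fun H hH => if_neg fun h => hH h.1, fun H hH => if_neg fun h => hH (by omega),
      fun H hH => ?_⟩
    by_cases hc : H.card = c + 1
    · have : koszul 1 (fun H => y H - koszul 1 u H) H = z H := by
        rw [koszul_sub, koszul_koszul, sub_zero, hy2 H hH]
      rw [← this]
      refine koszul_congr fun v hv => ?_
      have hcv : (H.erase v).card = c := by rw [Finset.card_erase_of_mem hv]; omega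
      by_cases hvK : (H.erase v)ᶜ ∈ K
      · rw [if_pos ⟨hvK, hcv⟩]
      · rw [if_neg fun h => hvK h.1,
          hu _ ⟨hvK, (Finset.erase_subset _ _).trans hH⟩ hcv, sub_self]
    · rw [hz2 H hc, koszul_congr (ψ := fun _ => 0)]
      · simp [koszul]
      · intro v hv
        refine if_neg fun h => hc ?_
        have := Finset.card_erase_add_one hv
        omega
  · intro h w hw
    let y : Finset V → k := fun H => if H ∈ inducedSub (dualComplex K) W ∧ H.card = c then w H else 0
    have hL : ∀ F ∈ inducedSub (dualComplex K) W, ∀ G ⊆ F, G ∈ inducedSub (dualComplex K) W :=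
      fun F hF G hG => ⟨fun h => hF.1 (hK.2 _ h _ (Finset.compl_subset_compl.2 hG)),
        hG.trans hF.2⟩
    have hyc : ∀ H : Finset V, H.card ≠ c + 1 → koszul 1 y H = 0 := by
      intro H hc
      rw [koszul_congr (ψ := fun _ => 0)]
      · simp [koszul]
      · intro v hv
        refine if_neg fun h => hc ?_
        have := Finset.card_erase_add_one hv
        omega
    obtain ⟨b, hb1, hb2, hb3⟩ := h (fun H => if H ⊆ W then koszul 1 y H else 0)
      (fun H hH => by
        split_ifs with hHW
        · by_cases hc : H.card = c + 1
          · rw [← hw H ⟨hH, hHW⟩ hc]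
            refine koszul_congr fun v hv => if_pos ⟨hL H ⟨hH, hHW⟩ _ (Finset.erase_subset _ _), ?_⟩
            rw [Finset.card_erase_of_mem hv]; omega
          · exact hyc H hc
        · rfl)
      (fun H hH => by rw [hyc H hH, ite_self])
      (fun H hH => by
        rw [koszul_congr (ψ := koszul 1 y)]
        · exact koszul_koszul _ _ _
        · intro v _
          exact if_pos ((Finset.erase_subset _ _).trans hH))
    obtain ⟨u, -, hu⟩ := exists_koszul_one_eq hW c (fun H => y H - b H)
      (fun H _ hc => by
        rw [hb2 H (by omega), sub_zero]
        exact if_neg fun h => hc h.2)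
      (fun H hH => by
        rw [koszul_sub, ← hb3 H hH, if_pos hH, sub_self])
    refine ⟨u, fun H hH hc => ?_⟩
    rw [← hu H hH.2, hb1 H hH.1, sub_zero]
    exact (if_pos ⟨hH, hc⟩).symm

theorem reducedHomologyVanishes_dual_iff (hK : IsComplex K) (hKuniv : Finset.univ ∉ K)
    {W : Finset V} {m : ℕ} (hm : m ≤ W.card) :
    reducedHomologyVanishes k (inducedSub (dualComplex K) W) ((m : ℤ) - 2) ↔
      CochainExact k K W m := by
  cases m with
  | zero =>
    refine iff_of_true (by simp [reducedHomologyVanishes]) fun c hc1 hc2 _ => ?_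
    refine ⟨0, by simp, by simp, fun H _ => ?_⟩
    have hcH : c H = 0 := by
      by_cases hH : H.card = 0
      · rw [Finset.card_eq_zero.1 hH]
        exact hc1 ∅ (by simpa using hKuniv)
      · exact hc2 H hH
    rw [hcH]
    simp [koszul]
  | succ c =>
    have hW : W.Nonempty := Finset.card_pos.1 (by omega)
    rw [← cohomologyVanishes_dual_iff hK hW,
      ← reducedHomologyVanishes_iff_cohomologyVanishes]
    · refine iff_of_eq (congrArg _ ?_)
      push_cast; ring
    · exact fun F hF G hG => ⟨fun h => hF.1 (hK.2 _ h _ (Finset.compl_subset_compl.2 hG)),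
        hG.trans hF.2⟩

end DualComplexes

end SerrePaper

namespace SerrePaper

lemma not_bettiNonzero_empty {V : Type} [LinearOrder V] (k : Type) [Field k] (i j : ℕ) : ¬ bettiNonzero k (∅ : Set (Finset V)) i j := by
  rintro ⟨W, -, h⟩
  refine h ?_
  have h0 : ∀ c, Subsingleton (chainGroup k (inducedSub (∅ : Set (Finset V)) W) c) := by
    intro c
    have : IsEmpty {F : Finset V // F ∈ inducedSub ∅ W ∧ F.card = c} := ⟨fun F => F.2.1.1⟩
    infer_instance
  unfold reducedHomologyVanishes
  split_ifs
  · exact fun z => ⟨0, (h0 _).elim _ _⟩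
  · exact fun z _ => ⟨0, (h0 _).elim _ _⟩

section Comparison

variable {V : Type} [LinearOrder V] [Fintype V] {k : Type} [Field k] {K : Set (Finset V)}

lemma le_card_of_not_cochainExact {W : Finset V} {m : ℕ} (h : ¬ CochainExact k K W m) :
    m ≤ W.card := by
  by_contra! hm
  refine h fun c _ hc _ => ⟨0, by simp, by simp, fun H hH => ?_⟩
  rw [hc H fun h => (Finset.card_le_card hH).not_gt (h ▸ hm)]
  simp [koszul]

lemma compl_mem_of_not_cochainExact {W : Finset V} (h : ¬ CochainExact k K W W.card) :
    Wᶜ ∈ K := by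
  by_contra hW
  refine h fun c hc hc' _ => ⟨0, by simp, by simp, fun H hH => ?_⟩
  have : c H = 0 := by
    by_cases hcard : H.card = W.card
    · rw [Finset.eq_of_subset_of_card_le hH hcard.ge]
      exact hc W hW
    · exact hc' H hcard
  rw [this]
  simp [koszul]

lemma not_cochainExact_compl {F : Finset V} (hF : F ∈ K) (hmax : ∀ G ∈ K, G.card ≤ F.card) :
    ¬ CochainExact k K Fᶜ Fᶜ.card := by
  intro h
  obtain ⟨b, hb, -, hb'⟩ := h (fun H => if H = Fᶜ then 1 else 0)
    (fun H hH => if_neg fun h => hH (by simpa [h] using hF))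
    (fun H hH => if_neg fun h => hH (congrArg Finset.card h))
    (fun H hH => Finset.sum_eq_zero fun v hv => by
      dsimp only
      rw [if_neg, mul_zero, mul_zero]
      · intro h
        have := hH hv
        rw [← h] at this
        simp at this)
  have h1 := hb' Fᶜ subset_rfl
  rw [if_pos rfl, koszul, Finset.sum_eq_zero] at h1
  · exact one_ne_zero h1
  · intro v hv
    rw [hb, mul_zero, mul_zero]
    intro h
    rw [Finset.compl_erase, compl_compl] at h
    have := hmax _ h
    rw [Finset.card_insert_of_notMem (by simpa using hv)] at this
    omega

/-- The degrees `j` in which some Betti number `β_{i,i+j}` with `i ≤ s` of the dual ideal is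
nonzero, in terms of cochains. -/
def nonexactDegrees (k : Type) [Field k] (K : Set (Finset V)) (s : ℕ) : Set ℕ :=
  {j | ∃ W : Finset V, j ≤ W.card ∧ W.card ≤ j + s ∧ ¬ CochainExact k K W j}

lemma le_card_of_mem_nonexactDegrees {s j : ℕ} (h : j ∈ nonexactDegrees k K s) :
    j ≤ Fintype.card V := by
  obtain ⟨W, hW, -⟩ := h
  exact hW.trans (Finset.card_le_univ W)

lemma card_sub_mem_nonexactDegrees {d : ℕ} (hd : HasDimCard K d) (s : ℕ) :
    Fintype.card V - d ∈ nonexactDegrees k K s := by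
  obtain ⟨⟨F, hF, rfl⟩, hmax⟩ := hd
  rw [← Finset.card_compl]
  exact ⟨Fᶜ, le_rfl, Nat.le_add_right _ _, not_cochainExact_compl hF hmax⟩

lemma serreDepth_eq (hK : IsComplex K) {r : ℕ} (hr : 1 ≤ r)
    (hne : (nonexactDegrees k K (r - 1)).Nonempty) :
    serreDepth k r (srRing k K) = Fintype.card V - sSup (nonexactDegrees k K (r - 1)) := by
  set T := nonexactDegrees k K (r - 1) with hT
  have hmem : ∀ j ≤ Fintype.card V, ((j + 1 - r : ℕ) : WithBot ℕ∞) ≤ modDim (serreK k (srRing k K) j) ↔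
      Fintype.card V - j ∈ T := by
    intro j hjn
    rw [serreK, le_modDim_extM_iff hK, Nat.card_eq_fintype_card]
    constructor
    · rintro ⟨A, hA, hA'⟩
      refine ⟨Aᶜ, le_card_of_not_cochainExact hA', ?_, hA'⟩
      rw [Finset.card_compl]
      omega
    · rintro ⟨W, hW1, hW2, hW3⟩
      refine ⟨Wᶜ, ?_, by rwa [compl_compl]⟩
      have := Finset.card_le_univ W
      rw [Finset.card_compl]
      omega
  have hbdd : BddAbove T := ⟨_, fun j hj => le_card_of_mem_nonexactDegrees hj⟩
  have hsup := Nat.sSup_mem hne hbdd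
  have hle := le_card_of_mem_nonexactDegrees hsup
  have h1 := (hmem (Fintype.card V - sSup T) (Nat.sub_le _ _)).2 (by rwa [Nat.sub_sub_self hle])
  refine le_antisymm (Nat.sInf_le h1) (le_csInf ⟨_, h1⟩ fun j hj => ?_)
  rcases le_total j (Fintype.card V) with hjn | hjn
  · have := le_csSup hbdd ((hmem j hjn).1 hj)
    omega
  · exact (Nat.sub_le _ _).trans hjn

lemma bettiNonzero_dual_iff (hK : IsComplex K) (hKuniv : Finset.univ ∉ K) (i j : ℕ) :
    bettiNonzero k (dualComplex K) (i + 1) (i + j) ↔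
      ∃ W : Finset V, W.card = i + j ∧ ¬ CochainExact k K W j := by
  refine exists_congr fun W => and_congr_right fun hW => not_congr ?_
  rw [← reducedHomologyVanishes_dual_iff hK hKuniv (by omega : j ≤ W.card)]
  refine iff_of_eq (congrArg _ ?_)
  push_cast; ring

lemma regLEIdeal_dual (hK : IsComplex K) (hKuniv : Finset.univ ∉ K) (s : ℕ) :
    regLEIdeal k (dualComplex K) s = sSup (nonexactDegrees k K s) := by
  refine congrArg sSup (Set.ext fun j => ?_)
  constructor
  · rintro ⟨i, hi, h⟩
    obtain ⟨W, hW, hW'⟩ := (bettiNonzero_dual_iff hK hKuniv i j).1 h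
    exact ⟨W, by omega, by omega, hW'⟩
  · rintro ⟨W, hW1, hW2, hW3⟩
    exact ⟨W.card - j, by omega,
      (bettiNonzero_dual_iff hK hKuniv _ j).2 ⟨W, by omega, hW3⟩⟩

lemma indegIdeal_dual (hK : IsComplex K) (hKuniv : Finset.univ ∉ K) {d : ℕ}
    (hd : HasDimCard K d) : indegIdeal k (dualComplex K) = Fintype.card V - d := by
  have hmem : ∀ j, bettiNonzero k (dualComplex K) 1 j ↔
      ∃ W : Finset V, W.card = j ∧ ¬ CochainExact k K W j := by
    intro j
    simpa using bettiNonzero_dual_iff (k := k) hK hKuniv 0 j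
  obtain ⟨⟨F, hF, rfl⟩, hmax⟩ := hd
  rw [← Finset.card_compl]
  have h1 := (hmem _).2 ⟨Fᶜ, rfl, not_cochainExact_compl hF hmax⟩
  refine le_antisymm (Nat.sInf_le h1) (le_csInf ⟨_, h1⟩ fun j hj => ?_)
  obtain ⟨W, rfl, hW⟩ := (hmem j).1 hj
  have := hmax _ (compl_mem_of_not_cochainExact hW)
  rw [Finset.card_compl] at *
  omega

lemma sSup_nonexactDegrees_of_univ_mem (hK : IsComplex K) (hKuniv : Finset.univ ∈ K) (s : ℕ) :
    sSup (nonexactDegrees k K s) = 0 := by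
  have hall : ∀ F, F ∈ K := fun F => hK.2 _ hKuniv F (Finset.subset_univ F)
  have h0 : ∀ j ∈ nonexactDegrees k K s, j = 0 := by
    rintro j ⟨W, hW, -, h⟩
    rcases W.eq_empty_or_nonempty with rfl | hW'
    · simpa using hW
    · refine absurd (fun c _ hc1 hc2 => ?_) h
      obtain ⟨b, hb1, hb2⟩ := exists_koszul_one_eq hW' j c (fun G _ => hc1 G) hc2
      exact ⟨b, fun H hH => absurd (hall _) hH, hb1, hb2⟩
  have h1 : nonexactDegrees k K s ⊆ {0} := h0
  rcases Set.subset_singleton_iff_eq.1 h1 with h | h <;> rw [h] <;> simp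

end Comparison

/-- Corollary `gene`: for a pure simplicial complex `Δ` on `[n]` and
`r ≥ 2`, `reg_{≤ r-1} I_{Δ^∨} - indeg I_{Δ^∨} = dim k[Δ] - S_r-depth(k[Δ])`. -/
theorem regLE_sub_indeg_eq_dim_sub_serreDepth
    (k : Type) [Field k] (n r : ℕ) (hr : 2 ≤ r)
    (K : Set (Finset (Fin n))) (hK : IsComplex K) (hpure : Pure K)
    (d : ℕ) (hd : modDim (srRing k K) = (d : WithBot ℕ∞)) :
    (regLEIdeal k (dualComplex K) (r - 1) : ℤ) - indegIdeal k (dualComplex K) =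
      (d : ℤ) - serreDepth k r (srRing k K) := by
  have hdim := hasDimCard_of_modDim_eq hK hd
  have hne : n - d ∈ nonexactDegrees k K (r - 1) := by
    simpa using card_sub_mem_nonexactDegrees (k := k) hdim (r - 1)
  have hle : sSup (nonexactDegrees k K (r - 1)) ≤ n := by
    refine csSup_le ⟨_, hne⟩ fun j hj => ?_
    simpa using le_card_of_mem_nonexactDegrees hj
  have hdn : d ≤ n := by
    obtain ⟨⟨F, -, rfl⟩, -⟩ := hdim
    simpa using Finset.card_le_univ F
  rw [serreDepth_eq hK (by omega) ⟨_, hne⟩, Fintype.card_fin]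
  by_cases hKuniv : Finset.univ ∈ K
  · have hdual : dualComplex K = ∅ :=
      Set.eq_empty_of_forall_notMem fun F hF => hF (hK.2 _ hKuniv _ (Finset.subset_univ _))
    have hnd : n ≤ d := by simpa using hdim.2 _ hKuniv
    rw [sSup_nonexactDegrees_of_univ_mem hK hKuniv, hdual, regLEIdeal, indegIdeal]
    simp only [not_bettiNonzero_empty, and_false, exists_false, Set.ofPred_false, csSup_empty,
      Nat.sInf_empty]
    simp
    omega
  · rw [regLEIdeal_dual hK hKuniv, indegIdeal_dual hK hKuniv hdim, Fintype.card_fin]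
    omega

end SerrePaper
end

section
/- Let Δ be a simplicial complex on [n] and r ≥ 2 such that k[Δ] is unmixed. Then S_r-depth(k[Δ]) ≤ S_r-depth(k[link_Δ F]) + |F| for every face F ∈ Δ. -/
/-!
Common definitions for formalizing "The Serre depth of Stanley–Reisner rings and
the depth of their symbolic powers" (Muta–Terai).
-/

open CategoryTheory MvPolynomial

noncomputable section

namespace SerrePaper

universe u v

open Abelian CochainComplex HomComplex in
lemma extMk_eq_zero_iff_exists {C : Type u} [Category.{v} C] [Abelian C] [HasExt.{v} C] {X Y : C}
    (P : ProjectiveResolution X) {n : ℕ} (f : P.complex.X n ⟶ Y)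
    (hf : P.complex.d (n + 1) n ≫ f = 0) :
    P.extMk f (n + 1) rfl hf = 0 ↔ ∃ p, ∃ g : P.complex.X p ⟶ Y, P.complex.d n p ≫ g = f := by
  constructor
  · intro h
    cases n with
    | zero =>
      rw [← P.extEquivCohomologyClass.apply_eq_iff_eq,
        ProjectiveResolution.extEquivCohomologyClass_extMk,
        ProjectiveResolution.extEquivCohomologyClass_zero,
        CohomologyClass.mk_eq_zero_iff] at h
      rw [Cocycle.toSingleMk_mem_coboundaries_iff _ _ _ _ _ 1 (by lia)] at h
      obtain ⟨g, hg⟩ := h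
      refine ⟨0, 0, ?_⟩
      rw [(P.cochainComplex.isZero_of_isStrictlyLE 0 1).eq_of_src g 0, Limits.comp_zero] at hg
      rw [← cancel_epi (P.cochainComplexXIso (-(0 : ℕ)) 0 rfl).hom, ← hg]
      simp
    | succ n =>
      obtain ⟨g, hg⟩ := (P.extMk_eq_zero_iff f _ rfl hf n rfl).1 h
      exact ⟨n, g, hg⟩
  · rintro ⟨p, g, hg⟩
    by_cases hp : p + 1 = n
    · exact (P.extMk_eq_zero_iff f _ rfl hf p hp).2 ⟨g, hg⟩
    · rw [P.complex.shape _ _ hp, Limits.zero_comp] at hg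
      subst hg
      exact P.extMk_zero _ rfl

lemma smul_extMk {R : Type u} [CommRing R] {C : Type*} [Category.{v} C] [Abelian C]
    [HasExt.{v} C] [Linear R C] {X Y : C}
    (P : ProjectiveResolution X) {n : ℕ} (f : P.complex.X n ⟶ Y)
    (hf : P.complex.d (n + 1) n ≫ f = 0) (a : R) :
    a • P.extMk f (n + 1) rfl hf = P.extMk (a • f) (n + 1) rfl (by simp [hf]) := by
  simp [Abelian.Ext.smul_eq_comp_mk₀, ProjectiveResolution.extMk_comp_mk₀]

lemma mem_annihilator_ext_iff {R : Type u} [CommRing R] {M N : ModuleCat.{u} R}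
    (P : ProjectiveResolution M) {n : ℕ} {a : R} :
    a ∈ Module.annihilator R (Abelian.Ext M N n) ↔ ∀ f : P.complex.X n ⟶ N,
      P.complex.d (n + 1) n ≫ f = 0 → ∃ p, ∃ g : P.complex.X p ⟶ N, P.complex.d n p ≫ g = a • f := by
  rw [Module.mem_annihilator]
  constructor
  · intro h f hf
    exact (extMk_eq_zero_iff_exists P (a • f) (by simp [hf])).1
      ((smul_extMk P f hf a).symm.trans (h _))
  · intro h e
    obtain ⟨f, hf, rfl⟩ := P.extMk_surjective e _ rfl
    rw [smul_extMk, extMk_eq_zero_iff_exists]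
    exact h f hf

lemma mem_annihilator_Ext_obj_iff {R : Type u} [CommRing R] {M N : ModuleCat.{u} R}
    (P : ProjectiveResolution M) {n : ℕ} {a : R} :
    a ∈ Module.annihilator R (((Ext R (ModuleCat.{u} R) n).obj (Opposite.op M)).obj N) ↔
      ∀ f : P.complex.X n ⟶ N, P.complex.d (n + 1) n ≫ f = 0 →
        ∃ p, ∃ g : P.complex.X p ⟶ N, P.complex.d n p ≫ g = a • f := by
  let S := (P.complex.linearYonedaObj R N).sc n
  rw [(P.isoExt (R := R) n N ≪≫ S.moduleCatHomologyIso).toLinearEquiv.annihilator_eq]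
  change a ∈ Module.annihilator R
    (LinearMap.ker S.g.hom ⧸ LinearMap.range S.moduleCatToCycles) ↔ _
  rw [Submodule.annihilator_quotient, Submodule.mem_colon]
  have hS (f : P.complex.X n ⟶ N) :
      S.g.hom f = 0 ↔ P.complex.d (n + 1) n ≫ f = 0 := by
    change P.complex.d ((ComplexShape.up ℕ).next n) n ≫ f = 0 ↔ _
    rw [CochainComplex.next]
  constructor
  · intro h f hf
    obtain ⟨g, hg⟩ := h ⟨f, (hS f).2 hf⟩ trivial
    exact ⟨_, g, congrArg Subtype.val hg⟩
  · rintro h ⟨f, hf⟩ -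
    obtain ⟨p, g, hg⟩ := h f ((hS f).1 hf)
    by_cases hp : (ComplexShape.up ℕ).prev n = p
    · subst hp
      exact ⟨g, Subtype.ext hg⟩
    · refine ⟨0, Subtype.ext ?_⟩
      rw [P.complex.shape _ _ fun h ↦ hp (ComplexShape.prev_eq' _ h), Limits.zero_comp] at hg
      rw [map_zero]
      exact hg

lemma annihilator_Ext_obj_eq {R : Type u} [CommRing R] (M N : ModuleCat.{u} R) (n : ℕ) :
    Module.annihilator R (((Ext R (ModuleCat.{u} R) n).obj (Opposite.op M)).obj N) =
      Module.annihilator R (Abelian.Ext M N n) := by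
  ext a
  rw [mem_annihilator_Ext_obj_iff (projectiveResolution M),
    mem_annihilator_ext_iff (projectiveResolution M)]

section FlatBaseChange

variable {R B : Type u} [CommRing R] [CommRing B] (f : R →+* B)

instance : (ModuleCat.extendScalars.{u, u, u} f).PreservesProjectiveObjects :=
  Functor.preservesProjectiveObjects_of_adjunction_of_preservesEpimorphisms
    (ModuleCat.extendRestrictScalarsAdj f)

instance : (ModuleCat.extendScalars.{u, u, u} f).Additive :=
  (ModuleCat.extendRestrictScalarsAdj f).left_adjoint_additive

/-- A projective resolution stays one after flat base change. -/
def flatResolution {M : ModuleCat.{u} R} (P : ProjectiveResolution M) (hf : f.Flat) :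
    ProjectiveResolution ((ModuleCat.extendScalars.{u, u, u} f).obj M) :=
  have := ModuleCat.preservesFiniteLimits_extendScalars_of_flat hf
  (ModuleCat.extendScalars f).mapProjectiveResolution P

variable {f}

lemma exists_ext_extendScalars {M : ModuleCat.{u} R} (hf : f.Flat) {n : ℕ}
    (e : Abelian.Ext M (ModuleCat.of R R) n) :
    ∃ e' : Abelian.Ext ((ModuleCat.extendScalars.{u, u, u} f).obj M) (ModuleCat.of B B) n,
      ∀ (a y : B) (e'' : Abelian.Ext ((ModuleCat.extendScalars.{u, u, u} f).obj M)
        (ModuleCat.of B B) n) (π : B →+ R), (∀ r b, π (f r * b) = r * π b) →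
        (∀ b, π (y * b) = 0) → a • e' = y • e'' → π a • e = 0 := by
  let adj := ModuleCat.extendRestrictScalarsAdj.{u, u, u} f
  let P := projectiveResolution M
  let Q := flatResolution f P hf
  obtain ⟨φ, hφ, rfl⟩ := P.extMk_surjective e _ rfl
  let η : ModuleCat.of R R ⟶ (ModuleCat.restrictScalars f).obj (ModuleCat.of B B) :=
    ModuleCat.ofHom (Y := (ModuleCat.restrictScalars f).obj (ModuleCat.of B B))
      { toFun := f, map_add' := map_add f, map_smul' := map_mul f }
  let φ' : Q.complex.X n ⟶ ModuleCat.of B B := (adj.homEquiv _ _).symm (φ ≫ η)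
  have hφ' : Q.complex.d (n + 1) n ≫ φ' = 0 := by
    change (ModuleCat.extendScalars f).map (P.complex.d (n + 1) n) ≫ φ' = 0
    rw [← adj.homEquiv_naturality_left_symm, ← Category.assoc, hφ, Limits.zero_comp,
      Equiv.symm_apply_eq]
    rfl
  refine ⟨Q.extMk φ' _ rfl hφ', fun a y e'' π hπ hy h ↦ ?_⟩
  let π' : (ModuleCat.restrictScalars f).obj (ModuleCat.of B B) ⟶ ModuleCat.of R R :=
    ModuleCat.ofHom (X := (ModuleCat.restrictScalars f).obj (ModuleCat.of B B))
      { toFun := π, map_add' := map_add π, map_smul' := hπ }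
  obtain ⟨ψ, hψ, rfl⟩ := Q.extMk_surjective e'' _ rfl
  rw [smul_extMk, smul_extMk, ← sub_eq_zero, ProjectiveResolution.sub_extMk,
    extMk_eq_zero_iff_exists] at h
  obtain ⟨p, g, hg⟩ := h
  rw [smul_extMk, extMk_eq_zero_iff_exists]
  refine ⟨p, adj.homEquiv _ _ g ≫ π', ?_⟩
  rw [← Category.assoc]
  refine (congrArg (· ≫ π') ((adj.homEquiv_naturality_left (P.complex.d n p) g).symm.trans
    (congrArg (adj.homEquiv _ _) hg))).trans ?_
  ext x
  have hx : (adj.homEquiv _ _ φ' x : B) = f (φ x) := by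
    rw [Equiv.apply_symm_apply]
    rfl
  let u : B := adj.homEquiv _ _ φ' x
  let w : B := adj.homEquiv _ _ ψ x
  change π (a * u - y * w) = π a * φ x
  rw [map_sub, hy, sub_zero, show u = f (φ x) from hx, mul_comm, hπ, mul_comm]

end FlatBaseChange

/-- The annihilator of `Ext_R^i(R/I, R)`. -/
def extAnn {R : Type u} [CommRing R] (I : Ideal R) (i : ℕ) : Ideal R :=
  Module.annihilator R (Abelian.Ext (ModuleCat.of R (R ⧸ I)) (ModuleCat.of R R) i)

lemma mul_mem_extAnn {R : Type u} [CommRing R] {I J : Ideal R} (hIJ : I ≤ J) {x a : R}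
    (hx : ∀ j ∈ J, x * j ∈ I) {i : ℕ} (ha : a ∈ extAnn I i) : x * a ∈ extAnn J i := by
  rw [extAnn, Module.mem_annihilator] at ha ⊢
  intro e
  let g₁ : ModuleCat.of R (R ⧸ J) ⟶ ModuleCat.of R (R ⧸ I) :=
    ModuleCat.ofHom (Submodule.mapQ J I (LinearMap.lsmul R R x) hx)
  let g₂ : ModuleCat.of R (R ⧸ I) ⟶ ModuleCat.of R (R ⧸ J) :=
    ModuleCat.ofHom (Submodule.mapQ I J LinearMap.id hIJ)
  have hg : g₁ ≫ g₂ = x • 𝟙 _ := by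
    refine ModuleCat.hom_ext (LinearMap.ext fun b ↦ ?_)
    obtain ⟨b, rfl⟩ := Submodule.Quotient.mk_surjective _ b
    rfl
  have hxe : x • e = (Abelian.Ext.mk₀ g₁).comp ((Abelian.Ext.mk₀ g₂).comp e (zero_add i))
      (zero_add i) := by
    rw [Abelian.Ext.mk₀_comp_mk₀_assoc, hg, Abelian.Ext.mk₀_smul, Abelian.Ext.smul_comp,
      Abelian.Ext.mk₀_id_comp]
  rw [mul_comm, mul_smul, hxe, ← Abelian.Ext.comp_smul, ha, Abelian.Ext.comp_zero]

section FlatExtAnn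

variable {R B : Type u} [CommRing R] [CommRing B] {f : R →+* B}

/-- The quotient of the target of a ring map by an extended ideal is a base change. -/
def extendScalarsQuotientIso (f : R →+* B) (I : Ideal R) :
    (ModuleCat.extendScalars.{u, u, u} f).obj (ModuleCat.of R (R ⧸ I)) ≅
      ModuleCat.of B (B ⧸ I.map f) :=
  letI := f.toAlgebra
  (Algebra.TensorProduct.quotIdealMapEquivTensorQuot B I).symm.toLinearEquiv.toModuleIso

lemma exists_ext_quotient_map (hf : f.Flat) {I : Ideal R} {n : ℕ}
    (e : Abelian.Ext (ModuleCat.of R (R ⧸ I)) (ModuleCat.of R R) n) :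
    ∃ e' : Abelian.Ext (ModuleCat.of B (B ⧸ I.map f)) (ModuleCat.of B B) n,
      ∀ (a y : B) (e'' : Abelian.Ext (ModuleCat.of B (B ⧸ I.map f)) (ModuleCat.of B B) n)
        (π : B →+ R), (∀ r b, π (f r * b) = r * π b) →
        (∀ b, π (y * b) = 0) → a • e' = y • e'' → π a • e = 0 := by
  obtain ⟨e', he'⟩ := exists_ext_extendScalars hf e
  let α := extendScalarsQuotientIso f I
  refine ⟨(Abelian.Ext.mk₀ α.inv).comp e' (zero_add n), fun a y e'' π hπ hy h ↦
    he' a y ((Abelian.Ext.mk₀ α.hom).comp e'' (zero_add n)) π hπ hy ?_⟩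
  rw [← Abelian.Ext.comp_smul, ← h, Abelian.Ext.comp_smul, Abelian.Ext.mk₀_comp_mk₀_assoc,
    α.hom_inv_id, Abelian.Ext.mk₀_id_comp]

lemma map_mem_extAnn_of_flat (hf : f.Flat) {I : Ideal R} {i : ℕ} {a : B} (π : B →+ R)
    (hπ : ∀ r b, π (f r * b) = r * π b) (ha : a ∈ extAnn (I.map f) i) : π a ∈ extAnn I i := by
  rw [extAnn, Module.mem_annihilator] at ha ⊢
  intro e
  obtain ⟨e', he'⟩ := exists_ext_quotient_map hf e
  exact he' a 0 0 π hπ (by simp) (by rw [ha, smul_zero])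

/-- Rees' shift: passing to the quotient by a regular element raises the degree by one. -/
lemma map_mem_extAnn_of_regular (hf : f.Flat) {I : Ideal R} {i : ℕ} {a y : B} (π : B →+ R)
    (hπ : ∀ r b, π (f r * b) = r * π b) (hy : ∀ b, y * b ∈ I.map f → b ∈ I.map f)
    (hπy : ∀ b, π (y * b) = 0) (ha : a ∈ extAnn (I.map f ⊔ Ideal.span {y}) (i + 1)) :
    π a ∈ extAnn I i := by
  rw [extAnn, Module.mem_annihilator] at ha ⊢
  intro e
  obtain ⟨e', he'⟩ := exists_ext_quotient_map hf e
  let J := I.map f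
  let T : ShortComplex (ModuleCat.{u} B) :=
    { X₁ := ModuleCat.of B (B ⧸ J)
      X₂ := ModuleCat.of B (B ⧸ J)
      X₃ := ModuleCat.of B (B ⧸ (J ⊔ Ideal.span {y}))
      f := y • 𝟙 _
      g := ModuleCat.ofHom (Submodule.mapQ J _ LinearMap.id le_sup_left)
      zero := by
        refine ModuleCat.hom_ext (LinearMap.ext fun b ↦ ?_)
        obtain ⟨b, rfl⟩ := Submodule.Quotient.mk_surjective _ b
        exact (Submodule.Quotient.mk_eq_zero _).2 (Ideal.mul_mem_right _ _
          (Ideal.mem_sup_right (Ideal.mem_span_singleton_self y))) }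
  have hT : T.ShortExact := by
    refine ModuleCat.shortComplex_shortExact _ (fun b ↦ ⟨fun hb ↦ ?_, ?_⟩) ?_ ?_
    · obtain ⟨b, rfl⟩ := Submodule.Quotient.mk_surjective _ b
      obtain ⟨j, hj, z, hz, rfl⟩ := Submodule.mem_sup.1 ((Submodule.Quotient.mk_eq_zero _).1 hb)
      obtain ⟨c, rfl⟩ := Ideal.mem_span_singleton.1 hz
      refine ⟨Submodule.Quotient.mk c, (Submodule.Quotient.eq J).2 ?_⟩
      change y * c - (j + y * c) ∈ J
      rw [sub_add_cancel_right]
      exact neg_mem hj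
    · rintro ⟨b, rfl⟩
      exact ConcreteCategory.congr_hom T.zero b
    · refine (injective_iff_map_eq_zero T.f.hom).2 fun b hb ↦ ?_
      obtain ⟨b, rfl⟩ := Submodule.Quotient.mk_surjective _ b
      exact (Submodule.Quotient.mk_eq_zero _).2 (hy b ((Submodule.Quotient.mk_eq_zero J).1 hb))
    · intro b
      obtain ⟨b, rfl⟩ := Submodule.Quotient.mk_surjective _ b
      exact ⟨Submodule.Quotient.mk b, rfl⟩
  obtain ⟨e'', h⟩ := Abelian.Ext.contravariant_sequence_exact₁ hT _ (a • e') (add_comm 1 i)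
    (by rw [Abelian.Ext.comp_smul, ha])
  refine he' a y e'' π hπ hπy ?_
  rw [← h]
  change (Abelian.Ext.mk₀ (y • 𝟙 _)).comp e'' _ = _
  rw [Abelian.Ext.mk₀_smul, Abelian.Ext.smul_comp, Abelian.Ext.mk₀_id_comp]

end FlatExtAnn

lemma map_mem_extAnn_of_ringEquiv {R B : Type u} [CommRing R] [CommRing B] (e : B ≃+* R)
    {I : Ideal R} {i : ℕ} {a : B} (ha : a ∈ extAnn (I.comap e) i) : e a ∈ extAnn I i := by
  rw [← Ideal.map_symm] at ha
  exact map_mem_extAnn_of_flat (f := (e.symm : R →+* B))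
    (RingHom.Flat.of_bijective e.symm.bijective) e.toAddMonoidHom (fun r b ↦ by simp) ha

lemma coeff_zero_mem_extAnn {R : Type u} [CommRing R] {I : Ideal R} {i : ℕ} {a : Polynomial R}
    (ha : a ∈ extAnn (I.comap Polynomial.constantCoeff) (i + 1)) : a.coeff 0 ∈ extAnn I i := by
  have h : I.comap Polynomial.constantCoeff = I.map Polynomial.C ⊔ Ideal.span {Polynomial.X} := by
    refine le_antisymm (fun p hp ↦ ?_) (sup_le ?_ ?_)
    · rw [← p.divX_mul_X_add, add_comm]
      exact add_mem (Ideal.mem_sup_left (Ideal.mem_map_of_mem _ hp)) (Ideal.mem_sup_right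
        (Ideal.mul_mem_left _ _ (Ideal.mem_span_singleton_self _)))
    · exact Ideal.map_le_iff_le_comap.2 fun x hx ↦ by simpa
    · rw [Ideal.span_singleton_le_iff_mem]
      simp
  rw [h] at ha
  refine map_mem_extAnn_of_regular (f := Polynomial.C) ?_ (Polynomial.lcoeff R 0).toAddMonoidHom
    (fun r b ↦ by simp) (fun b hb ↦ ?_) (fun b ↦ by simp) ha
  · rw [← Polynomial.algebraMap_eq, RingHom.flat_algebraMap_iff]
    infer_instance
  · rw [Ideal.mem_map_C_iff] at hb ⊢
    intro m
    simpa using hb (m + 1)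

lemma constantCoeff_mem_extAnn {R τ : Type u} [CommRing R] [Finite τ] {I : Ideal R} {i : ℕ}
    {a : MvPolynomial τ R} (ha : a ∈ extAnn (I.comap constantCoeff) (i + Nat.card τ)) :
    constantCoeff a ∈ extAnn I i := by
  induction τ using Finite.induction_empty_option generalizing i with
  | of_equiv e ih =>
    let e' := renameEquiv R e.symm
    have h (p) : constantCoeff (e' p) = constantCoeff p := constantCoeff_rename _ p
    have hI : (I.comap constantCoeff).comap e'.toRingEquiv = I.comap constantCoeff := by
      ext p
      simp [Ideal.mem_comap, h]
    rw [← h]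
    refine ih (map_mem_extAnn_of_ringEquiv e'.toRingEquiv ?_)
    rwa [hI, Nat.card_congr e]
  | h_empty =>
    rw [Nat.card_of_isEmpty, add_zero] at ha
    exact map_mem_extAnn_of_ringEquiv (isEmptyRingEquiv R PEmpty) ha
  | @h_option α _ ih =>
    let e := optionEquivLeft R α
    have h (p) : constantCoeff ((e p).coeff 0) = constantCoeff p := by
      simpa [constantCoeff_eq] using optionEquivLeft_coeff_some_coeff_none R α 0 p
    have hI : ((I.comap constantCoeff).comap Polynomial.constantCoeff).comap e.toRingEquiv =
        I.comap constantCoeff := by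
      ext p
      simp [Ideal.mem_comap, h]
    rw [← h]
    refine ih (coeff_zero_mem_extAnn (map_mem_extAnn_of_ringEquiv e.toRingEquiv ?_))
    rw [hI]
    rwa [Finite.card_option, ← add_assoc] at ha

lemma extAnn_map_C_le {R τ : Type u} [CommRing R] (I : Ideal R) (i : ℕ) :
    extAnn (I.map (C : R →+* MvPolynomial τ R)) i ≤ (extAnn I i).map C := by
  intro p hp
  rw [mem_map_C_iff]
  intro m
  refine map_mem_extAnn_of_flat (f := (C : R →+* MvPolynomial τ R)) ?_
    (lcoeff R m).toAddMonoidHom (fun r b ↦ by simp) hp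
  rw [← algebraMap_eq, RingHom.flat_algebraMap_iff]
  infer_instance

lemma ringKrullDim_quotient_add_card_le {R B τ : Type u} [CommRing R] [CommRing B] [Finite τ]
    (δ : B →+* MvPolynomial τ R) (hδ : Function.Surjective δ) {A : Ideal B} {I : Ideal R}
    (h : ∀ a ∈ A, δ a ∈ I.map C) :
    ringKrullDim (R ⧸ I) + Nat.card τ ≤ ringKrullDim (B ⧸ A) := by
  let g : B ⧸ A →+* MvPolynomial τ R ⧸ I.map (C : R →+* MvPolynomial τ R) :=
    Ideal.quotientMap _ δ h
  refine (ringKrullDim_add_natCard_le_ringKrullDim_mvPolynomial τ).trans ?_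
  rw [ringKrullDim_eq_of_ringEquiv (quotientEquivQuotientMvPolynomial (σ := τ) I).toRingEquiv]
  exact ringKrullDim_le_of_surjective g (Ideal.quotientMap_surjective hδ)

lemma mem_map_C_of_prod_X_mul_mem {R τ : Type*} [CommRing R] {I : Ideal R} (s : Finset τ)
    {p : MvPolynomial τ R} (hp : (∏ i ∈ s, X i) * p ∈ I.map C) : p ∈ I.map C := by
  classical
  induction s using Finset.induction_on with
  | empty => simpa using hp
  | insert i s hi ih =>
    rw [Finset.prod_insert hi, mul_assoc, mem_map_C_iff] at hp
    refine ih (mem_map_C_iff.2 fun m ↦ ?_)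
    rw [← coeff_X_mul m i]
    exact hp _

section Link

variable {V : Type} [DecidableEq V] (K : Set (Finset V)) (F : Finset V)

/-- The elements of the ground set outside `F` which are not vertices of `link K F`. -/
abbrev LinkCompl : Type := {v : V // v ∉ F ∧ {v} ∉ link K F}

variable {K F} in
lemma notMem_of_singleton_mem_link {v : V} (hv : {v} ∈ link K F) : v ∉ F := by
  simpa [Finset.singleton_inter] using hv.2

/-- A face of a complex splits its ground set into the elements away from its star, the face
and the vertices of its link. -/
def linkEquiv : LinkCompl K F ⊕ (F ⊕ {v : V // {v} ∈ link K F}) ≃ V :=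
  Equiv.ofBijective (Sum.elim Subtype.val (Sum.elim Subtype.val Subtype.val)) <| by
    constructor
    · rintro (⟨a, ha⟩ | ⟨a, ha⟩ | ⟨a, ha⟩) (⟨b, hb⟩ | ⟨b, hb⟩ | ⟨b, hb⟩) (rfl : a = b)
      · rfl
      · exact (ha.1 hb).elim
      · exact (ha.2 hb).elim
      · exact (hb.1 ha).elim
      · rfl
      · exact (notMem_of_singleton_mem_link hb ha).elim
      · exact (hb.2 ha).elim
      · exact (notMem_of_singleton_mem_link ha hb).elim
      · rfl
    · intro v
      by_cases hF : v ∈ F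
      · exact ⟨.inr (.inl ⟨v, hF⟩), rfl⟩
      · by_cases hL : {v} ∈ link K F
        · exact ⟨.inr (.inr ⟨v, hL⟩), rfl⟩
        · exact ⟨.inl ⟨v, hF, hL⟩, rfl⟩

lemma card_linkEquiv [Finite V] :
    Nat.card V = Nat.card {v : V // {v} ∈ link K F} + F.card + Nat.card (LinkCompl K F) := by
  rw [← Nat.card_congr (linkEquiv K F), Nat.card_sum, Nat.card_sum,
    Nat.card_eq_fintype_card (α := F), Fintype.card_coe, add_comm, add_comm F.card]

variable (k : Type) [Field k]

/-- The polynomial ring on the ground set, split along `linkEquiv`. -/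
def linkPolyEquiv : MvPolynomial V k ≃ₐ[k]
    MvPolynomial (LinkCompl K F) (MvPolynomial F (MvPolynomial {v : V // {v} ∈ link K F} k)) :=
  (renameEquiv k (linkEquiv K F).symm).trans
    ((sumAlgEquiv k _ _).trans (mapAlgEquiv _ (sumAlgEquiv k _ _)))

/-- The map killing the variables away from the star of `F`. -/
def linkPolyHom : MvPolynomial V k →+*
    MvPolynomial F (MvPolynomial {v : V // {v} ∈ link K F} k) :=
  constantCoeff.comp (linkPolyEquiv K F k).toRingEquiv.toRingHom

variable {K F k}

lemma linkPolyHom_apply (p : MvPolynomial V k) :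
    linkPolyHom K F k p = constantCoeff (linkPolyEquiv K F k p) := rfl

lemma linkPolyEquiv_X_inl (v : LinkCompl K F) : linkPolyEquiv K F k (X v.1) = X v := by
  have : (linkEquiv K F).symm v.1 = .inl v := (linkEquiv K F).symm_apply_apply (.inl v)
  simp [linkPolyEquiv, this]

lemma linkPolyEquiv_X_inr_inl (v : F) : linkPolyEquiv K F k (X v.1) = C (X v) := by
  have : (linkEquiv K F).symm v.1 = .inr (.inl v) :=
    (linkEquiv K F).symm_apply_apply (.inr (.inl v))
  simp [linkPolyEquiv, this]

lemma linkPolyEquiv_X_inr_inr (v : {v : V // {v} ∈ link K F}) :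
    linkPolyEquiv K F k (X v.1) = C (C (X v)) := by
  have : (linkEquiv K F).symm v.1 = .inr (.inr v) :=
    (linkEquiv K F).symm_apply_apply (.inr (.inr v))
  simp [linkPolyEquiv, this]

lemma linkPolyHom_surjective : Function.Surjective (linkPolyHom K F k) := fun p ↦
  ⟨(linkPolyEquiv K F k).symm (C p), by simp [linkPolyHom_apply]⟩

lemma linkPolyHom_prod_link (G : Finset {v : V // {v} ∈ link K F}) :
    linkPolyHom K F k (∏ v ∈ G.map (.subtype _), X v) = C (∏ v ∈ G, X v) := by
  rw [Finset.prod_map, map_prod, map_prod]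
  exact Finset.prod_congr rfl fun v _ ↦ by simp [linkPolyHom_apply, linkPolyEquiv_X_inr_inr]

lemma linkPolyHom_prod_face :
    linkPolyHom K F k (∏ v ∈ F, X v) = ∏ v : F, X v := by
  rw [← Finset.prod_coe_sort, map_prod]
  exact Finset.prod_congr rfl fun v _ ↦ by simp [linkPolyHom_apply, linkPolyEquiv_X_inr_inl]

variable (k) in
lemma srIdeal_le_comap_linkPolyHom (hK : IsComplex K) :
    srIdeal k K ≤ ((srIdeal k (restrictVerts (link K F))).map C).comap (linkPolyHom K F k) := by
  classical
  rw [srIdeal, Ideal.span_le]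
  rintro _ ⟨H, hH, rfl⟩
  rw [SetLike.mem_coe, Ideal.mem_comap]
  by_cases hY : ∃ v ∈ H, v ∉ F ∧ {v} ∉ link K F
  · obtain ⟨v, hv, hvY⟩ := hY
    have : linkPolyHom K F k (X v) = 0 := by
      simp [linkPolyHom_apply, linkPolyEquiv_X_inl (k := k) ⟨v, hvY⟩]
    rw [map_prod, Finset.prod_eq_zero hv this]
    exact zero_mem _
  · push Not at hY
    let G : Finset {v : V // {v} ∈ link K F} := H.subtype _
    have hG : G.map (.subtype _) = H.filter ({·} ∈ link K F) := Finset.subtype_map _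
    have hGL : G ∉ restrictVerts (link K F) := by
      intro h
      refine hH (hK.2 _ h.1 _ fun v hv ↦ ?_)
      by_cases hvF : v ∈ F
      · exact Finset.mem_union_right _ hvF
      · rw [hG]
        exact Finset.mem_union_left _ (Finset.mem_filter.2 ⟨hv, hY v hv hvF⟩)
    refine Ideal.mem_of_dvd _ (map_dvd _ (Finset.prod_dvd_prod_of_subset _ _ _
      (hG.trans_subset (Finset.filter_subset _ _)))) ?_
    rw [linkPolyHom_prod_link]
    exact Ideal.mem_map_of_mem _ (Ideal.subset_span ⟨G, hGL, rfl⟩)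

lemma prod_face_mul_mem_srIdeal {p : MvPolynomial V k}
    (hp : linkPolyHom K F k p ∈ (srIdeal k (restrictVerts (link K F))).map C) :
    (∏ v ∈ F, X v) * p ∈ srIdeal k K := by
  let Q : Ideal (MvPolynomial V k) := Submodule.comap
    (LinearMap.mulLeft (MvPolynomial V k) (∏ v ∈ F, X v)) (srIdeal k K)
  let s : MvPolynomial F (MvPolynomial {v : V // {v} ∈ link K F} k) →+* MvPolynomial V k :=
    (linkPolyEquiv K F k).symm.toRingEquiv.toRingHom.comp C
  have hs (p) : s p = (linkPolyEquiv K F k).symm (C p) := rfl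
  have hsQ : ((Ideal.Quotient.mk Q).comp s).comp (linkPolyHom K F k) = Ideal.Quotient.mk Q := by
    have h (p : MvPolynomial V k) (hp : linkPolyEquiv K F k p = C (linkPolyHom K F k p)) :
        s (linkPolyHom K F k p) = p := by
      rw [hs, ← hp, AlgEquiv.symm_apply_apply]
    refine ringHom_ext (fun r ↦ congrArg _ (h _ ?_)) fun v ↦ ?_
    · have := (linkPolyEquiv K F k).commutes r
      rw [algebraMap_eq] at this
      rw [linkPolyHom_apply, this]
      simp [MvPolynomial.algebraMap_apply]
    · obtain ⟨v | v | v, rfl⟩ := (linkEquiv K F).surjective v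
      · have : linkPolyHom K F k (X v.1) = 0 := by
          rw [linkPolyHom_apply, linkPolyEquiv_X_inl, constantCoeff_X]
        change Ideal.Quotient.mk Q (s (linkPolyHom K F k (X v.1))) = Ideal.Quotient.mk Q (X v.1)
        rw [this, map_zero, map_zero, eq_comm, Ideal.Quotient.eq_zero_iff_mem]
        refine Ideal.subset_span ⟨insert v.1 F, fun h ↦ v.2.2 ⟨?_, ?_⟩, ?_⟩
        · rwa [← Finset.insert_eq]
        · exact Finset.singleton_inter_of_notMem v.2.1
        · rw [Finset.prod_insert v.2.1, mul_comm]
          rfl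
      · refine congrArg _ (h (X v.1) ?_)
        rw [linkPolyHom_apply, linkPolyEquiv_X_inr_inl, constantCoeff_C]
      · refine congrArg _ (h (X v.1) ?_)
        rw [linkPolyHom_apply, linkPolyEquiv_X_inr_inr, constantCoeff_C]
  have hL : (srIdeal k (restrictVerts (link K F))).map C ≤ Q.comap s := by
    rw [srIdeal, Ideal.map_span, Ideal.span_le]
    rintro _ ⟨_, ⟨G, hG, rfl⟩, rfl⟩
    have hGF : Disjoint (G.map (.subtype _)) F := by
      rw [Finset.disjoint_left]
      rintro _ hv
      obtain ⟨v, -, rfl⟩ := Finset.mem_map.1 hv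
      exact notMem_of_singleton_mem_link v.2
    refine Ideal.subset_span ⟨G.map (.subtype _) ∪ F,
      fun h ↦ hG ⟨h, Finset.disjoint_iff_inter_eq_empty.1 hGF⟩, ?_⟩
    have : s (C (∏ v ∈ G, X v)) = ∏ v ∈ G.map (.subtype _), X v := by
      rw [Finset.prod_map, hs, AlgEquiv.symm_apply_eq, map_prod, map_prod, map_prod]
      exact Finset.prod_congr rfl fun v _ ↦ (linkPolyEquiv_X_inr_inr v).symm
    rw [Finset.prod_union hGF, ← this, mul_comm]
    rfl
  have := hL hp
  rw [Ideal.mem_comap, ← Ideal.Quotient.eq_zero_iff_mem] at this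
  exact (Ideal.Quotient.eq_zero_iff_mem (I := Q)).1 ((RingHom.congr_fun hsQ p).symm.trans this)

lemma linkPolyHom_mem_extAnn [Finite V] (hK : IsComplex K) {i : ℕ} {a : MvPolynomial V k}
    (ha : a ∈ extAnn (srIdeal k K) (i + Nat.card (LinkCompl K F))) :
    linkPolyHom K F k a ∈ (extAnn (srIdeal k (restrictVerts (link K F))) i).map C := by
  let I := srIdeal k (restrictVerts (link K F))
  have hI : ((I.map C).comap constantCoeff).comap (linkPolyEquiv K F k).toRingEquiv =
      (I.map C).comap (linkPolyHom K F k) := rfl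
  have h₁ : (∏ v ∈ F, X v) * a ∈ extAnn _ _ :=
    mul_mem_extAnn (srIdeal_le_comap_linkPolyHom (F := F) k hK)
      (fun p hp ↦ prod_face_mul_mem_srIdeal hp) ha
  rw [← hI] at h₁
  have h₂ := constantCoeff_mem_extAnn (map_mem_extAnn_of_ringEquiv _ h₁)
  have h₃ : linkPolyHom K F k (∏ v ∈ F, X v) * linkPolyHom K F k a ∈ (extAnn I i).map C := by
    rw [← map_mul]
    exact extAnn_map_C_le _ _ h₂
  rw [linkPolyHom_prod_face] at h₃
  exact mem_map_C_of_prod_X_mul_mem _ h₃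

lemma modDim_serreK_srRing {W : Type} (L : Set (Finset W)) (j : ℕ) :
    modDim (serreK k (srRing k L) j) =
      ringKrullDim (MvPolynomial W k ⧸ extAnn (srIdeal k L) (Nat.card W - j)) := by
  unfold modDim serreK extM
  rw [annihilator_Ext_obj_eq]
  rfl

lemma modDim_serreK_link_add_card_le [Finite V] (hK : IsComplex K) {j : ℕ}
    (hj : j ≤ Nat.card {v : V // {v} ∈ link K F}) :
    modDim (serreK k (srRing k (restrictVerts (link K F))) j) + F.card ≤
      modDim (serreK k (srRing k K) (j + F.card)) := by
  have hV := card_linkEquiv K F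
  have hn : Nat.card V - (j + F.card) =
    Nat.card {v : V // {v} ∈ link K F} - j + Nat.card (LinkCompl K F) := by lia
  have := ringKrullDim_quotient_add_card_le _ linkPolyHom_surjective
    fun a ha ↦ linkPolyHom_mem_extAnn (k := k) (F := F)
      (i := Nat.card {v : V // {v} ∈ link K F} - j) hK ha
  rw [modDim_serreK_srRing, modDim_serreK_srRing, hn]
  simpa using this

end Link

lemma extAnn_bot_zero {R : Type u} [CommRing R] : extAnn (⊥ : Ideal R) 0 = ⊥ := by
  rw [eq_bot_iff]
  intro a ha
  rw [extAnn, Module.mem_annihilator] at ha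
  let g : ModuleCat.of R (R ⧸ (⊥ : Ideal R)) ⟶ ModuleCat.of R R :=
    ModuleCat.ofHom (Submodule.quotEquivOfEqBot (⊥ : Ideal R) rfl : _ →ₗ[R] R)
  have h := ha (Abelian.Ext.mk₀ g)
  rw [← Abelian.Ext.mk₀_smul, Abelian.Ext.mk₀_eq_zero_iff] at h
  have h₁ : a • (1 : R) = 0 := ConcreteCategory.congr_hom h (Submodule.Quotient.mk (1 : R))
  simpa using h₁

lemma exists_isFacet {V : Type} [Finite V] {K : Set (Finset V)} (hK : IsComplex K) :
    ∃ G, IsFacet K G := by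
  obtain ⟨G, hG⟩ := K.toFinite.exists_maximal hK.1
  exact ⟨G, hG.prop, fun H hH hGH ↦ (hG.eq_of_le hH hGH).symm⟩

section SerreDepth

variable {V : Type} [DecidableEq V]

lemma IsComplex.restrictVerts_link {K : Set (Finset V)} (hK : IsComplex K) {F : Finset V}
    (hF : F ∈ K) : IsComplex (restrictVerts (link K F)) := by
  refine ⟨⟨∅, ?_, ?_⟩, fun G hG H hHG ↦ ⟨?_, ?_⟩⟩
  · rwa [Finset.map_empty, Finset.empty_union]
  · rw [Finset.map_empty, Finset.empty_inter]
  · exact hK.2 _ hG.1 _ (Finset.union_subset_union_left (Finset.map_subset_map.2 hHG))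
  · refine Finset.subset_empty.1 (hG.2 ▸ ?_)
    exact Finset.inter_subset_inter_right (Finset.map_subset_map.2 hHG)

lemma isEmpty_vertices_link {K : Set (Finset V)} {G : Finset V} (hG : IsFacet K G) :
    IsEmpty {v : V // {v} ∈ link K G} := by
  refine ⟨fun ⟨v, hv⟩ ↦ notMem_of_singleton_mem_link hv ?_⟩
  rw [← hG.2 _ hv.1 Finset.subset_union_right]
  simp

lemma card_le_modDim_serreK_of_isFacet [Finite V] {k : Type} [Field k] {K : Set (Finset V)}
    (hK : IsComplex K) {G : Finset V} (hG : IsFacet K G) :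
    (G.card : WithBot ℕ∞) ≤ modDim (serreK k (srRing k K) G.card) := by
  have h := modDim_serreK_link_add_card_le (k := k) (F := G) hK (Nat.zero_le _)
  rw [zero_add] at h
  refine le_trans ?_ h
  have := isEmpty_vertices_link hG
  have hbot : srIdeal k (restrictVerts (link K G)) = ⊥ := by
    refine Ideal.span_eq_bot.2 ?_
    rintro _ ⟨H, hH, rfl⟩
    obtain ⟨E, hE⟩ := (hK.restrictVerts_link hG.1).1
    exact (hH (Subsingleton.elim E H ▸ hE)).elim
  rw [modDim_serreK_srRing, hbot, Nat.sub_zero, Nat.card_of_isEmpty, extAnn_bot_zero]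
  exact le_add_of_nonneg_left ringKrullDim_nonneg_of_nontrivial

lemma serreDepth_srRing_mem [Finite V] {k : Type} [Field k] {r : ℕ} (hr : 1 ≤ r)
    {K : Set (Finset V)} (hK : IsComplex K) :
    ((serreDepth k r (srRing k K) + 1 - r : ℕ) : WithBot ℕ∞) ≤
      modDim (serreK k (srRing k K) (serreDepth k r (srRing k K))) := by
  obtain ⟨G, hG⟩ := exists_isFacet hK
  refine Nat.sInf_mem (s := {j : ℕ | ((j + 1 - r : ℕ) : WithBot ℕ∞) ≤
    modDim (serreK k (srRing k K) j)}) ⟨G.card, ?_⟩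
  refine le_trans ?_ (card_le_modDim_serreK_of_isFacet hK hG)
  exact_mod_cast (by lia : G.card + 1 - r ≤ G.card)

lemma serreDepth_srRing_le_card [Finite V] {k : Type} [Field k] {r : ℕ} (hr : 1 ≤ r)
    {K : Set (Finset V)} (hK : IsComplex K) : serreDepth k r (srRing k K) ≤ Nat.card V := by
  by_contra! h
  refine h.not_ge (Nat.sInf_le ?_)
  have hmem := serreDepth_srRing_mem (k := k) hr hK
  have hK' : serreK k (srRing k K) (serreDepth k r (srRing k K)) =
      serreK k (srRing k K) (Nat.card V) := by
    simp only [serreK, Nat.sub_self, Nat.sub_eq_zero_of_le h.le]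
  rw [hK'] at hmem
  refine le_trans ?_ hmem
  exact_mod_cast (by lia)

end SerreDepth

end SerrePaper

end

namespace SerrePaper

/-- for a simplicial complex `Δ` on `[n]` with `k[Δ]` unmixed and `r ≥ 2`,
`S_r-depth(k[Δ]) ≤ S_r-depth(k[link_Δ F]) + |F|` for every face `F ∈ Δ`, where
`k[link_Δ F]` is taken over the polynomial ring on the vertex set of `link_Δ F`. -/
theorem serreDepth_le_serreDepth_link_add_card
    (k : Type) [Field k] (n r : ℕ) (hr : 2 ≤ r)
    (K : Set (Finset (Fin n))) (hK : IsComplex K)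
    (hunm : IsUnmixedIdeal (srIdeal k K))
    (F : Finset (Fin n)) (hF : F ∈ K) :
    serreDepth k r (srRing k K) ≤
      serreDepth k r (srRing k (restrictVerts (link K F))) + F.card := by
  have hL := hK.restrictVerts_link hF
  refine Nat.sInf_le (le_trans ?_ (modDim_serreK_link_add_card_le hK
    (serreDepth_srRing_le_card (by lia) hL)))
  refine le_trans ?_ (add_le_add_left (serreDepth_srRing_mem (r := r) (by lia) hL) _)
  exact_mod_cast (by lia)

end SerrePaper
end
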